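/- Suppose W, Z ⊆ ℕ satisfy W ≰_T Z, and f : [ℕ]^3 → ℕ is a 2-bounded coloring (of arbitrary complexity, with no computability hypothesis on f). Then there exists an infinite tail f-rainbow X such that W ≰_T X ⊕ Z. -/

import Mathlib

namespace RRT

/-- Partial functions on ℕ that are recursive in the oracle `O`.
This mirrors `Nat.Partrec`, with an extra constructor for the oracle. -/
inductive RecursiveIn (O : ℕ →. ℕ) : (ℕ →. ℕ) → Prop
  | zero : RecursiveIn O (pure 0)
  | succ : RecursiveIn O Nat.succ
  | left : RecursiveIn O ↑fun n : ℕ => n.unpair.1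
  | right : RecursiveIn O ↑fun n : ℕ => n.unpair.2
  | oracle : RecursiveIn O O
  | pair {f g} : RecursiveIn O f → RecursiveIn O g →
      RecursiveIn O fun n => Nat.pair <$> f n <*> g n
  | comp {f g} : RecursiveIn O f → RecursiveIn O g →
      RecursiveIn O fun n => g n >>= f
  | prec {f g} : RecursiveIn O f → RecursiveIn O g →
      RecursiveIn O (Nat.unpaired fun a n =>
        n.rec (f a) fun y IH => do let i ← IH; g (Nat.pair a (Nat.pair y i)))
  | rfind {f} : RecursiveIn O f →
      RecursiveIn O fun a => Nat.rfind fun n => (fun m => m = 0) <$> f (Nat.pair a n)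

/-- The characteristic function of a set of naturals. -/
noncomputable def chi (A : Set ℕ) : ℕ → ℕ := A.indicator fun _ => 1

/-- Turing reducibility `A ≤_T B` for sets of naturals: the characteristic function of `A`
is computable relative to an oracle for the characteristic function of `B`. -/
def TuringLE (A B : Set ℕ) : Prop := RecursiveIn (chi B) (chi A)

/-- The recursive join `A ⊕ B = {2n : n ∈ A} ∪ {2n+1 : n ∈ B}`. -/
def join (A B : Set ℕ) : Set ℕ :=
  {n : ℕ | (∃ m ∈ A, n = 2 * m) ∨ (∃ m ∈ B, n = 2 * m + 1)}

/-- A total function `f : ℕ → ℕ` is computable relative to an oracle for `Z ⊆ ℕ`. -/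
def FunRecIn (Z : Set ℕ) (f : ℕ → ℕ) : Prop := RecursiveIn (chi Z) f


/-- A coloring of `[ℕ]³` (identified with strictly increasing triples) is 2-bounded if
every color has at most 2 preimages. -/
def Bounded2Triples (f : ℕ → ℕ → ℕ → ℕ) : Prop :=
  ∀ c : ℕ, {t : ℕ × ℕ × ℕ | t.1 < t.2.1 ∧ t.2.1 < t.2.2 ∧ f t.1 t.2.1 t.2.2 = c}.encard ≤ 2

/-- `X` is a tail `f`-rainbow for a coloring of triples: triples from `X` with distinct
last-two coordinates get distinct colors. -/
def TailRainbow3On (f : ℕ → ℕ → ℕ → ℕ) (X : Set ℕ) : Prop :=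
  ∀ x₀ x₁ x₂ y₀ y₁ y₂ : ℕ, x₀ ∈ X → x₁ ∈ X → x₂ ∈ X → y₀ ∈ X → y₁ ∈ X → y₂ ∈ X →
    x₀ < x₁ → x₁ < x₂ → y₀ < y₁ → y₁ < y₂ →
    (x₁, x₂) ≠ (y₁, y₂) → f x₀ x₁ x₂ ≠ f y₀ y₁ y₂


/-! ## Effectively open predicates -/

abbrev Orc := ℕ → Bool

/-- finite initial part of an oracle -/
def pre (A : Orc) (k : ℕ) : List Bool := (List.range k).map A

theorem pre_length (A : Orc) (k : ℕ) : (pre A k).length = k := by simp [pre]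

theorem pre_get (A : Orc) (k n : ℕ) : (pre A k)[n]? = if n < k then some (A n) else none := by
  unfold pre
  split_ifs with h
  · simp [h]
  · simp; omega

theorem pre_mono_len (A : Orc) {k l : ℕ} (h : k ≤ l) : pre A k <+: pre A l := by
  have : pre A k = (pre A l).take k := by
    unfold pre
    rw [← List.map_take, List.take_range, min_eq_left h]
  rw [this]
  exact ⟨_, List.take_append_drop _ _⟩

theorem pre_congr {A B : Orc} {k : ℕ} (h : ∀ m < k, A m = B m) : pre A k = pre B k := by
  unfold pre
  apply List.map_congr_left
  intro a ha
  exact h a (List.mem_range.1 ha)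

theorem eq_pre_iff (A : Orc) (σ : List Bool) :
    σ = pre A σ.length ↔ ∀ m ∈ List.range σ.length, A m = σ.getD m false := by
  constructor
  · intro h m hm
    have hm' := List.mem_range.1 hm
    have := congrArg (fun l : List Bool => l[m]?) h
    simp only [pre_get, hm', if_true] at this
    simp [List.getD, this]
  · intro h
    apply List.ext_getElem?
    intro m
    rw [pre_get]
    split_ifs with hm
    · have := h m (List.mem_range.2 hm)
      rw [this]
      simp [List.getD, hm]
    · simp; omega

section EO
variable {α : Type*} {β : Type*} [Primcodable α] [Primcodable β]

/-- uniformly effectively open predicates -/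
def EO (P : Orc → α → Prop) : Prop :=
  ∃ v : List Bool × α → Prop, PrimrecPred v ∧ (∀ σ τ a, σ <+: τ → v (σ, a) → v (τ, a)) ∧
    ∀ A a, P A a ↔ ∃ k, v (pre A k, a)

theorem EO.of_iff {P Q : Orc → α → Prop} (h : EO P) (e : ∀ A a, Q A a ↔ P A a) : EO Q := by
  have : Q = P := by
    funext A a
    exact propext (e A a)
  rw [this]; exact h

theorem EO.prim {p : α → Prop} (h : PrimrecPred p) : EO (fun _ a => p a) :=
  ⟨fun x => p x.2, h.comp Primrec.snd, fun _ _ _ _ h => h, fun A a => by simp⟩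

theorem EO.query {f : α → ℕ} {g : α → Bool} (hf : Primrec f) (hg : Primrec g) :
    EO (fun A a => A (f a) = g a) := by
  refine ⟨fun x => x.1[f x.2]? = some (g x.2), ?_, ?_, ?_⟩
  · exact Primrec.eq.comp (Primrec.list_getElem?.comp Primrec.fst (hf.comp Primrec.snd))
      (Primrec.option_some.comp (hg.comp Primrec.snd))
  · rintro σ τ a ⟨ρ, rfl⟩ h
    simp only at h ⊢
    rw [List.getElem?_append_left, h]
    by_contra hc
    rw [List.getElem?_eq_none (by omega)] at h
    cases h
  · intro A a
    simp only [pre_get]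
    constructor
    · intro h
      exact ⟨f a + 1, by simp [h]⟩
    · rintro ⟨k, hk⟩
      split_ifs at hk with h
      simpa using hk

theorem EO.and {P Q : Orc → α → Prop} (hP : EO P) (hQ : EO Q) : EO (fun A a => P A a ∧ Q A a) := by
  obtain ⟨v, v1, v2, v3⟩ := hP
  obtain ⟨w, w1, w2, w3⟩ := hQ
  refine ⟨fun x => v x ∧ w x, v1.and w1, fun σ τ a h1 h2 => ⟨v2 _ _ _ h1 h2.1, w2 _ _ _ h1 h2.2⟩, ?_⟩
  intro A a
  simp only [v3, w3]
  constructor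
  · rintro ⟨⟨k, hk⟩, l, hl⟩
    exact ⟨max k l, v2 _ _ _ (pre_mono_len A (le_max_left _ _)) hk,
      w2 _ _ _ (pre_mono_len A (le_max_right _ _)) hl⟩
  · rintro ⟨k, h1, h2⟩
    exact ⟨⟨k, h1⟩, k, h2⟩

theorem EO.or {P Q : Orc → α → Prop} (hP : EO P) (hQ : EO Q) : EO (fun A a => P A a ∨ Q A a) := by
  obtain ⟨v, v1, v2, v3⟩ := hP
  obtain ⟨w, w1, w2, w3⟩ := hQ
  refine ⟨fun x => v x ∨ w x, v1.or w1, fun σ τ a h1 h2 => h2.imp (v2 _ _ _ h1) (w2 _ _ _ h1), ?_⟩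
  intro A a
  simp only [v3, w3, exists_or]

theorem EO.comp {P : Orc → β → Prop} (hP : EO P) {f : α → β} (hf : Primrec f) :
    EO (fun A a => P A (f a)) := by
  obtain ⟨v, v1, v2, v3⟩ := hP
  refine ⟨fun x => v (x.1, f x.2), v1.comp (Primrec.fst.pair (hf.comp Primrec.snd)),
    fun σ τ a h1 h2 => v2 _ _ _ h1 h2, fun A a => v3 _ _⟩

theorem EO.ex {P : Orc → α → β → Prop} (hP : EO (fun A (x : α × β) => P A x.1 x.2)) :
    EO (fun A a => ∃ b, P A a b) := by
  obtain ⟨v, v1, v2, v3⟩ := hP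
  refine ⟨fun x => ∃ b ∈ (List.range x.1.length).filterMap (Encodable.decode : ℕ → Option β),
    v (x.1, (x.2, b)), ?_, ?_, ?_⟩
  · have h1 : PrimrecRel (fun (b : β) (x : List Bool × α) => v (x.1, (x.2, b))) :=
      v1.comp ((Primrec.fst.comp Primrec.snd).pair ((Primrec.snd.comp Primrec.snd).pair Primrec.fst))
    exact (PrimrecRel.exists_mem_list h1).comp
      (Primrec.listFilterMap (Primrec.list_range.comp (Primrec.list_length.comp Primrec.fst))
        (Primrec.decode.comp Primrec.snd)) Primrec.id
  · rintro σ τ a h1 ⟨b, hb, h2⟩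
    refine ⟨b, ?_, v2 _ _ _ h1 h2⟩
    simp only [List.mem_filterMap, List.mem_range] at hb ⊢
    obtain ⟨j, hj, hb⟩ := hb
    exact ⟨j, lt_of_lt_of_le hj h1.length_le, hb⟩
  · intro A a
    constructor
    · rintro ⟨b, hb⟩
      obtain ⟨k, hk⟩ := (v3 A (a, b)).1 hb
      refine ⟨max k (Encodable.encode b + 1), b, ?_, v2 _ _ _ (pre_mono_len A (le_max_left _ _)) hk⟩
      simp only [List.mem_filterMap, List.mem_range, pre_length]
      exact ⟨Encodable.encode b, by simp, by simp⟩
    · rintro ⟨k, b, _, hb⟩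
      exact ⟨b, (v3 A (a, b)).2 ⟨k, hb⟩⟩

theorem EO.ball {P : Orc → α → β → Prop} (hP : EO (fun A (x : α × β) => P A x.1 x.2))
    {f : α → List β} (hf : Primrec f) : EO (fun A a => ∀ b ∈ f a, P A a b) := by
  obtain ⟨v, v1, v2, v3⟩ := hP
  refine ⟨fun x => ∀ b ∈ f x.2, v (x.1, (x.2, b)), ?_, ?_, ?_⟩
  · have h1 : PrimrecRel (fun (b : β) (x : List Bool × α) => v (x.1, (x.2, b))) :=
      v1.comp ((Primrec.fst.comp Primrec.snd).pair ((Primrec.snd.comp Primrec.snd).pair Primrec.fst))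
    exact (PrimrecRel.forall_mem_list h1).comp (hf.comp Primrec.snd) Primrec.id
  · intro σ τ a h1 h2 b hb
    exact v2 _ _ _ h1 (h2 b hb)
  · intro A a
    constructor
    · intro h
      change ∀ b ∈ f a, P A a b at h
      change ∃ k, ∀ b ∈ f a, v (pre A k, (a, b))
      revert h
      generalize f a = l
      intro h
      induction l with
      | nil => exact ⟨0, by simp⟩
      | cons b l ih =>
        obtain ⟨k, hk⟩ := ih (fun c hc => h c (List.mem_cons_of_mem _ hc))
        obtain ⟨k', hk'⟩ := (v3 A (a, b)).1 (h b List.mem_cons_self)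
        refine ⟨max k k', ?_⟩
        intro c hc
        rcases List.mem_cons.1 hc with rfl | hc
        · exact v2 _ _ _ (pre_mono_len A (le_max_right _ _)) hk'
        · exact v2 _ _ _ (pre_mono_len A (le_max_left _ _)) (hk c hc)
    · rintro ⟨k, hk⟩ b hb
      exact (v3 A (a, b)).2 ⟨k, hk b hb⟩

theorem EO.bex {P : Orc → α → β → Prop} (hP : EO (fun A (x : α × β) => P A x.1 x.2))
    {f : α → List β} (hf : Primrec f) : EO (fun A a => ∃ b ∈ f a, P A a b) := by
  refine EO.ex (P := fun A a b => b ∈ f a ∧ P A a b) (EO.and (EO.prim ?_) hP)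
  refine PrimrecPred.of_eq (p := fun x : α × β => ∃ c ∈ f x.1, c = x.2) ?_ (by simp)
  exact (PrimrecRel.exists_mem_list (Primrec.eq (α := β))).comp (hf.comp Primrec.fst) Primrec.snd

/-- oracle substitution -/
theorem EO.osubst {P : Orc → α → Prop} (hP : EO P) {Θ : Orc → α → Orc}
    (hΘ : EO (fun O (x : (α × ℕ) × Bool) => Θ O x.1.1 x.1.2 = x.2)) :
    EO (fun O a => P (Θ O a) a) := by
  obtain ⟨v, v1, v2, v3⟩ := hP
  have key : EO (fun O (a : α) => ∃ τ : List Bool, v (τ, a) ∧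
      ∀ m ∈ List.range τ.length, Θ O a m = τ.getD m false) := by
    refine EO.ex (P := fun O a τ => v (τ, a) ∧
      ∀ m ∈ List.range τ.length, Θ O a m = τ.getD m false) (EO.and (EO.prim ?_) ?_)
    · exact v1.comp (Primrec.snd.pair Primrec.fst)
    · refine EO.ball (P := fun O (x : α × List Bool) m => Θ O x.1 m = x.2.getD m false) ?_
        (Primrec.list_range.comp (Primrec.list_length.comp Primrec.snd))
      exact hΘ.comp (f := fun x : (α × List Bool) × ℕ => ((x.1.1, x.2), x.1.2.getD x.2 false))
        (((Primrec.fst.comp Primrec.fst).pair Primrec.snd).pair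
          ((Primrec.list_getD false).comp (Primrec.snd.comp Primrec.fst) Primrec.snd))
  refine key.of_iff fun O a => ?_
  rw [v3]
  constructor
  · rintro ⟨k, hk⟩
    refine ⟨_, hk, ?_⟩
    rw [← eq_pre_iff, pre_length]
  · rintro ⟨τ, h1, h2⟩
    rw [← eq_pre_iff] at h2
    exact ⟨τ.length, h2 ▸ h1⟩

/-- join of oracles -/
def jn (A B : Orc) : Orc := fun n => if n % 2 = 0 then A (n / 2) else B (n / 2)

theorem jn_even (A B : Orc) (n : ℕ) : jn A B (2 * n) = A n := by simp [jn]
theorem jn_odd (A B : Orc) (n : ℕ) : jn A B (2 * n + 1) = B n := by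
  unfold jn
  rw [if_neg (by omega)]
  congr 1; omega

/-- all strings of a given length -/
def alls : ℕ → List (List Bool)
  | 0 => [[]]
  | n + 1 => (alls n).flatMap fun s => [s ++ [true], s ++ [false]]

theorem mem_alls (n : ℕ) (τ : List Bool) : τ ∈ alls n ↔ τ.length = n := by
  induction n generalizing τ with
  | zero => simp [alls]
  | succ n ih =>
    simp only [alls, List.mem_flatMap, ih]
    constructor
    · rintro ⟨s, hs, h⟩
      simp at h
      rcases h with rfl | rfl <;> simp [hs]
    · intro h
      rcases List.eq_nil_or_concat τ with rfl | ⟨s, b, rfl⟩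
      · simp at h
      · refine ⟨s, by simpa using h, ?_⟩
        cases b <;> simp

theorem primrec_alls : Primrec alls := by
  have : Primrec (fun n : ℕ => Nat.rec (motive := fun _ => List (List Bool)) [[]]
      (fun _ ih => ih.flatMap fun s => [s ++ [true], s ++ [false]]) n) := by
    refine Primrec.nat_rec₁ _ ?_
    refine Primrec.list_flatMap Primrec.snd ?_
    refine Primrec.list_cons.comp (Primrec.list_append.comp Primrec.snd (Primrec.const _))
      (Primrec.list_cons.comp (Primrec.list_append.comp Primrec.snd (Primrec.const _))
        (Primrec.const _))
  refine this.of_eq fun n => ?_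
  induction n with
  | zero => rfl
  | succ n ih => simp only [alls, ← ih]

def jstr (τ σ : List Bool) : List Bool :=
  (List.range (2 * σ.length)).map fun m =>
    if m % 2 = 0 then τ.getD (m / 2) false else σ.getD (m / 2) false

theorem primrec_jstr : Primrec₂ jstr := by
  refine Primrec.list_map (Primrec.list_range.comp
    (Primrec.nat_mul.comp (Primrec.const 2) (Primrec.list_length.comp Primrec.snd))) ?_
  have hd : Primrec fun x : (List Bool × List Bool) × ℕ => x.2 / 2 :=
    Primrec.nat_div.comp Primrec.snd (Primrec.const 2)
  refine Primrec.ite (Primrec.eq.comp (Primrec.nat_mod.comp Primrec.snd (Primrec.const 2))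
    (Primrec.const 0)) ?_ ?_
  · exact (Primrec.list_getD false).comp (Primrec.fst.comp Primrec.fst) hd
  · exact (Primrec.list_getD false).comp (Primrec.snd.comp Primrec.fst) hd

theorem jstr_pre (I Z : Orc) (k : ℕ) : jstr (pre I k) (pre Z k) = pre (jn I Z) (2 * k) := by
  unfold jstr
  rw [pre_length]
  conv_rhs => unfold pre
  apply List.map_congr_left
  intro m hm
  have hm := List.mem_range.1 hm
  have : m / 2 < k := by omega
  simp [jn, List.getD, pre_get, this]

theorem exists_pre (τ : List Bool) : ∃ I : Orc, τ = pre I τ.length :=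
  ⟨fun m => τ.getD m false, (eq_pre_iff _ _).2 fun _ _ => rfl⟩

theorem pre_cont (k : ℕ) (I : Orc) : ∀ᶠ J in nhds I, pre J k = pre I k := by
  have : ∀ᶠ J in nhds I, ∀ m ∈ Finset.range k, J m = I m := by
    rw [Filter.eventually_all_finset]
    intro m _
    have h := (continuous_apply (A := fun _ : ℕ => Bool) m).continuousAt (x := I)
    exact h.eventually (p := fun b => b = I m) (by simp)
  filter_upwards [this] with J hJ
  exact pre_congr fun m hm => hJ m (Finset.mem_range.2 hm)

theorem pre_jn_congr {A B Z : Orc} {k : ℕ} (h : ∀ m < k, A m = B m) :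
    pre (jn A Z) k = pre (jn B Z) k := by
  apply pre_congr
  intro m hm
  unfold jn
  split_ifs
  · exact h _ (by omega)
  · rfl

theorem pre_jn_of_pre {A B Z : Orc} {k : ℕ} (h : pre A k = pre B k) :
    pre (jn A Z) k = pre (jn B Z) k := by
  apply pre_jn_congr
  intro m hm
  have := congrArg (fun l : List Bool => l[m]?) h
  simpa [pre_get, hm] using this

/-- compactness -/
theorem EO.all {P : Orc → α → Prop} (hP : EO P) : EO (fun Z a => ∀ I, P (jn I Z) a) := by
  obtain ⟨v, v1, v2, v3⟩ := hP
  refine ⟨fun x => ∀ τ ∈ alls x.1.length, v (jstr τ x.1, x.2), ?_, ?_, ?_⟩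
  · have h1 : PrimrecRel (fun (τ : List Bool) (x : List Bool × α) => v (jstr τ x.1, x.2)) :=
      v1.comp ((primrec_jstr.comp Primrec.fst (Primrec.fst.comp Primrec.snd)).pair
        (Primrec.snd.comp Primrec.snd))
    exact (PrimrecRel.forall_mem_list h1).comp
      (primrec_alls.comp (Primrec.list_length.comp Primrec.fst)) Primrec.id
  · intro σ σ' a h1 h2 τ hτ
    simp only [mem_alls] at hτ h2
    obtain ⟨I, hI⟩ := exists_pre τ
    obtain ⟨Z, hZ⟩ := exists_pre σ'
    have hσ : σ = pre Z σ.length := by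
      have h5 : pre Z σ.length <+: σ' := by
        have := pre_mono_len Z h1.length_le
        rwa [← hZ] at this
      have h3 := List.prefix_of_prefix_length_le h1 h5 (by simp [pre_length])
      exact h3.eq_of_length (by simp [pre_length])
    have h4 := h2 (pre I σ.length) (pre_length _ _)
    rw [hσ] at h4
    rw [pre_length, jstr_pre] at h4
    rw [hI, hτ, hZ, pre_length, jstr_pre]
    exact v2 _ _ _ (pre_mono_len _ (by have := h1.length_le; omega)) h4
  · intro Z a
    simp only [pre_length, mem_alls]
    constructor
    · intro h
      simp only [v3] at h
      have hc : IsCompact (Set.univ : Set Orc) := isCompact_univ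
      obtain ⟨k, hk⟩ := hc.elim_directed_cover (fun k => {I : Orc | v (pre (jn I Z) k, a)})
        (by
          intro k
          rw [isOpen_iff_eventually]
          intro I hI
          filter_upwards [pre_cont k I] with J hJ
          have := pre_jn_of_pre (Z := Z) hJ
          simpa [this] using hI)
        (fun I _ => Set.mem_iUnion.2 (h I))
        (by
          intro k l
          exact ⟨max k l, fun I hI => v2 _ _ _ (pre_mono_len _ (le_max_left _ _)) hI,
            fun I hI => v2 _ _ _ (pre_mono_len _ (le_max_right _ _)) hI⟩)
      refine ⟨k, fun τ hτ => ?_⟩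
      obtain ⟨I, hI⟩ := exists_pre τ
      rw [hI, hτ, jstr_pre]
      exact v2 _ _ _ (pre_mono_len _ (by omega)) (hk (Set.mem_univ I))
    · rintro ⟨k, hk⟩ I
      have := hk (pre I k) (pre_length _ _)
      rw [jstr_pre] at this
      exact (v3 _ _).2 ⟨_, this⟩

theorem EO.use {P : Orc → α → Prop} (hP : EO P) {A : Orc} {a : α} (h : P A a) :
    ∃ k, ∀ B, pre B k = pre A k → P B a := by
  obtain ⟨v, v1, v2, v3⟩ := hP
  obtain ⟨k, hk⟩ := (v3 _ _).1 h
  exact ⟨k, fun B hB => (v3 _ _).2 ⟨k, hB ▸ hk⟩⟩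

theorem countable_EO : {P : Orc → α → Prop | EO P}.Countable := by
  classical
  have h1 : {f : ℕ → ℕ | Nat.Primrec f}.Countable := by
    have : ∀ f : {f : ℕ → ℕ // Nat.Primrec f}, ∃ c : Nat.Partrec.Code, c.eval = (f : ℕ → ℕ) :=
      fun f => Nat.Partrec.Code.exists_code.1 (Nat.Partrec.of_primrec f.2)
    choose c hc using this
    have hi : Function.Injective c := by
      intro f g h
      have h2 := hc f
      rw [h, hc g] at h2
      apply Subtype.ext
      funext n
      have := congrFun h2 n
      simpa using this.symm
    exact Set.countable_coe_iff.1 hi.countable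
  have h2 : {v : List Bool × α → Prop | PrimrecPred v}.Countable := by
    refine (h1.preimage_of_injOn (f := fun v : List Bool × α → Prop => fun n =>
      Encodable.encode ((Encodable.decode n).map fun x => decide (v x))) ?_).mono ?_
    · intro v hv w hw h
      funext x
      have := congrFun h (Encodable.encode x)
      simp only [Encodable.encodek, Option.map_some, Encodable.encode_inj] at this
      simpa using this
    · intro v hv
      have : Primrec fun x => decide (v x) := PrimrecPred.decide hv
      exact this
  refine (h2.image (fun v => fun A a => ∃ k, v (pre A k, a))).mono ?_
  rintro P ⟨v, v1, v2, v3⟩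
  exact ⟨v, v1, by funext A a; exact propext (v3 A a).symm⟩

end EO
end RRT

namespace RRT

/-- oracle as a partial function -/
def co (A : Orc) : ℕ → ℕ := fun n => (A n).toNat

def Red (W A : Orc) : Prop := RecursiveIn (co A) (co W)

theorem RecursiveIn.subst {O O' : ℕ →. ℕ} {g : ℕ →. ℕ} (h : RecursiveIn O g)
    (hO : RecursiveIn O' O) : RecursiveIn O' g := by
  induction h with
  | zero => exact .zero
  | succ => exact .succ
  | left => exact .left
  | right => exact .right
  | oracle => exact hO
  | pair _ _ h1 h2 => exact .pair h1 h2
  | comp _ _ h1 h2 => exact .comp h1 h2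
  | prec _ _ h1 h2 => exact .prec h1 h2
  | rfind _ h1 => exact .rfind h1

theorem RecursiveIn.of_partrec {O : ℕ →. ℕ} {g : ℕ →. ℕ} (h : Nat.Partrec g) :
    RecursiveIn O g := by
  induction h with
  | zero => exact .zero
  | succ => exact .succ
  | left => exact .left
  | right => exact .right
  | pair _ _ h1 h2 => exact .pair h1 h2
  | comp _ _ h1 h2 => exact .comp h1 h2
  | prec _ _ h1 h2 => exact .prec h1 h2
  | rfind _ h1 => exact .rfind h1

theorem Red.refl (A : Orc) : Red A A := RecursiveIn.oracle
theorem Red.trans {A B C : Orc} (h1 : Red A B) (h2 : Red B C) : Red A C :=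
  RecursiveIn.subst h1 h2

/-- use principle, normal form -/
def NF (A : Orc) (g : ℕ →. ℕ) : Prop :=
  ∃ Ψ : List Bool → ℕ →. ℕ, Partrec₂ Ψ ∧
    (∀ σ τ, σ <+: τ → ∀ n m, m ∈ Ψ σ n → m ∈ Ψ τ n) ∧
    (∀ k n m, m ∈ Ψ (pre A k) n → m ∈ g n) ∧
    (∀ n m, m ∈ g n → ∃ k, m ∈ Ψ (pre A k) n)

theorem rec_mono {f f' g g' : ℕ →. ℕ} (hf : ∀ n m, m ∈ f n → m ∈ f' n)
    (hg : ∀ n m, m ∈ g n → m ∈ g' n) (a n m : ℕ)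
    (h : m ∈ (n.rec (f a) fun y IH => IH.bind fun i => g (Nat.pair a (Nat.pair y i)) : Part ℕ)) :
    m ∈ (n.rec (f' a) fun y IH => IH.bind fun i => g' (Nat.pair a (Nat.pair y i)) : Part ℕ) := by
  induction n generalizing m with
  | zero => exact hf _ _ h
  | succ n ih =>
    simp only [Part.mem_bind_iff] at h ⊢
    obtain ⟨i, h1, h2⟩ := h
    exact ⟨i, ih i h1, hg _ _ h2⟩

theorem mem_rfind_iff {f : ℕ →. ℕ} {a m : ℕ} :
    m ∈ (Nat.rfind fun n => (fun m => decide (m = 0)) <$> f (Nat.pair a n)) ↔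
      0 ∈ f (Nat.pair a m) ∧ ∀ j < m, ∃ c, c ≠ 0 ∧ c ∈ f (Nat.pair a j) := by
  refine Nat.mem_rfind.trans ?_
  change (true ∈ Part.map _ (f (Nat.pair a m)) ∧ ∀ {k : ℕ}, k < m → false ∈ Part.map _ (f (Nat.pair a k))) ↔ _
  simp only [Part.mem_map_iff, decide_eq_true_eq, decide_eq_false_iff_not]
  constructor
  · rintro ⟨⟨x, h1, rfl⟩, h2⟩
    refine ⟨h1, fun j hj => ?_⟩
    obtain ⟨c, h3, h4⟩ := h2 hj
    exact ⟨c, h4, h3⟩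
  · rintro ⟨h1, h2⟩
    refine ⟨⟨0, h1, rfl⟩, fun {j} hj => ?_⟩
    obtain ⟨c, h3, h4⟩ := h2 j hj
    exact ⟨c, h4, h3⟩

theorem nf_computable {A : Orc} {g : ℕ → ℕ} (hg : Computable g) : NF A g :=
  ⟨fun _ n => Part.some (g n), (hg.comp Computable.snd).partrec, fun _ _ _ _ _ h => h,
    fun _ _ _ h => h, fun _ _ h => ⟨0, h⟩⟩

theorem nf_of_recursiveIn {A : Orc} {g : ℕ →. ℕ} (h : RecursiveIn (co A) g) : NF A g := by
  induction h with
  | zero => exact nf_computable (Computable.const 0)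
  | succ => exact nf_computable Computable.succ
  | left => exact nf_computable (Computable.fst.comp Computable.unpair)
  | right => exact nf_computable (Computable.snd.comp Computable.unpair)
  | oracle =>
    refine ⟨fun σ n => ((σ[n]?).map Bool.toNat : Option ℕ), ?_, ?_, ?_, ?_⟩
    · have h1 : Primrec₂ (fun (σ : List Bool) (n : ℕ) => (σ[n]?).map Bool.toNat) :=
        Primrec.option_map Primrec.list_getElem?
          ((Primrec.dom_bool Bool.toNat).comp Primrec.snd)
      exact h1.to_comp.ofOption
    · rintro σ τ ⟨ρ, rfl⟩ n m h
      simp only [Part.mem_ofOption, Option.mem_def, Option.map_eq_some_iff] at h ⊢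
      obtain ⟨b, h1, h2⟩ := h
      refine ⟨b, ?_, h2⟩
      rw [List.getElem?_append_left, h1]
      by_contra hc
      rw [List.getElem?_eq_none (by omega)] at h1
      cases h1
    · intro k n m h
      simp only [Part.mem_ofOption, Option.mem_def, Option.map_eq_some_iff, pre_get] at h
      obtain ⟨b, h1, h2⟩ := h
      split_ifs at h1
      simp only [Option.some.injEq] at h1
      simp [co, h1, h2]
    · intro n m h
      refine ⟨n + 1, ?_⟩
      simp only [Part.mem_ofOption, Option.mem_def, Option.map_eq_some_iff, pre_get]
      simpa [co, eq_comm] using h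
  | pair _ _ h1 h2 =>
    obtain ⟨F, F1, F2, F3, F4⟩ := h1
    obtain ⟨G, G1, G2, G3, G4⟩ := h2
    refine ⟨fun σ n => (F σ n).bind fun a => (G σ n).map fun b => Nat.pair a b, ?_, ?_, ?_, ?_⟩
    · refine Partrec.bind F1 (Partrec.map ?_ ?_)
      · exact Partrec.comp G1 Computable.fst
      · exact (Primrec₂.natPair.to_comp).comp (Computable.snd.comp Computable.fst) Computable.snd
    · intro σ τ hs n m h
      simp only [Part.mem_bind_iff, Part.mem_map_iff] at h ⊢
      obtain ⟨a, ha, b, hb, h⟩ := h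
      exact ⟨a, F2 _ _ hs _ _ ha, b, G2 _ _ hs _ _ hb, h⟩
    · intro k n m h
      simp only [Part.mem_bind_iff, Part.mem_map_iff, Seq.seq, Part.map_eq_map] at h ⊢
      obtain ⟨a, ha, b, hb, h⟩ := h
      exact ⟨_, ⟨a, F3 _ _ _ ha, rfl⟩, b, G3 _ _ _ hb, h⟩
    · intro n m h
      simp only [Part.mem_bind_iff, Part.mem_map_iff, Seq.seq, Part.map_eq_map] at h ⊢
      obtain ⟨_, ⟨a, ha, rfl⟩, b, hb, h⟩ := h
      obtain ⟨k, hk⟩ := F4 _ _ ha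
      obtain ⟨l, hl⟩ := G4 _ _ hb
      exact ⟨max k l, a, F2 _ _ (pre_mono_len A (le_max_left _ _)) _ _ hk, b,
        G2 _ _ (pre_mono_len A (le_max_right _ _)) _ _ hl, h⟩
  | comp _ _ h1 h2 =>
    obtain ⟨F, F1, F2, F3, F4⟩ := h1
    obtain ⟨G, G1, G2, G3, G4⟩ := h2
    refine ⟨fun σ n => (G σ n).bind fun a => F σ a, ?_, ?_, ?_, ?_⟩
    · refine Partrec.bind G1 ?_
      exact Partrec₂.comp F1 (Computable.fst.comp Computable.fst) Computable.snd
    · intro σ τ hs n m h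
      simp only [Part.mem_bind_iff] at h ⊢
      obtain ⟨a, ha, h⟩ := h
      exact ⟨a, G2 _ _ hs _ _ ha, F2 _ _ hs _ _ h⟩
    · intro k n m h
      obtain ⟨a, ha, h⟩ := Part.mem_bind_iff.1 h
      exact Part.mem_bind_iff.2 ⟨a, G3 _ _ _ ha, F3 _ _ _ h⟩
    · intro n m h
      simp only [Part.mem_bind_iff]
      obtain ⟨a, ha, h⟩ := Part.mem_bind_iff.1 h
      obtain ⟨k, hk⟩ := G4 _ _ ha
      obtain ⟨l, hl⟩ := F4 _ _ h
      exact ⟨max k l, a, G2 _ _ (pre_mono_len A (le_max_left _ _)) _ _ hk,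
        F2 _ _ (pre_mono_len A (le_max_right _ _)) _ _ hl⟩
  | prec _ _ h1 h2 =>
    obtain ⟨F, F1, F2, F3, F4⟩ := h1
    obtain ⟨G, G1, G2, G3, G4⟩ := h2
    refine ⟨fun σ p => (p.unpair.2.rec (F σ p.unpair.1) fun y IH =>
      IH.bind fun i => G σ (Nat.pair p.unpair.1 (Nat.pair y i)) : Part ℕ), ?_, ?_, ?_, ?_⟩
    · have hu : Computable fun x : List Bool × ℕ => x.2.unpair :=
        Computable.unpair.comp Computable.snd
      refine Partrec.nat_rec (α := List Bool × ℕ) (f := fun x => x.2.unpair.2)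
        (g := fun x => F x.1 x.2.unpair.1)
        (h := fun x yi => G x.1 (Nat.pair x.2.unpair.1 (Nat.pair yi.1 yi.2)))
        (Computable.snd.comp hu)
        (Partrec₂.comp F1 Computable.fst (Computable.fst.comp hu)) ?_
      refine Partrec₂.comp G1 (Computable.fst.comp Computable.fst) ?_
      refine (Primrec₂.natPair.to_comp).comp
        (Computable.fst.comp (hu.comp Computable.fst)) ?_
      exact (Primrec₂.natPair.to_comp).comp (Computable.fst.comp Computable.snd)
        (Computable.snd.comp Computable.snd)
    · intro σ τ hs n m h
      exact rec_mono (F2 σ τ hs) (G2 σ τ hs) _ _ _ h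
    · intro k n m h
      exact rec_mono (F3 k) (G3 k) _ _ _ h
    · intro p m h
      simp only [Nat.unpaired, Part.bind_eq_bind] at h ⊢
      generalize p.unpair.1 = a at h ⊢
      generalize p.unpair.2 = n at h ⊢
      induction n generalizing m with
      | zero => exact F4 _ _ h
      | succ n ih =>
        simp only [Part.mem_bind_iff] at h ⊢
        obtain ⟨i, h1, h2⟩ := h
        obtain ⟨k, hk⟩ := ih i h1
        obtain ⟨l, hl⟩ := G4 _ _ h2
        exact ⟨max k l, i, rec_mono (F2 _ _ (pre_mono_len A (le_max_left _ _)))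
          (G2 _ _ (pre_mono_len A (le_max_left _ _))) _ _ _ hk,
          G2 _ _ (pre_mono_len A (le_max_right _ _)) _ _ hl⟩
  | rfind _ h1 =>
    obtain ⟨F, F1, F2, F3, F4⟩ := h1
    refine ⟨fun σ a => Nat.rfind fun n => (fun m => decide (m = 0)) <$> F σ (Nat.pair a n),
      ?_, ?_, ?_, ?_⟩
    · refine Partrec.rfind (α := List Bool × ℕ)
        (p := fun x n => (fun m => decide (m = 0)) <$> F x.1 (Nat.pair x.2 n)) ?_
      refine Partrec.map (f := fun y : (List Bool × ℕ) × ℕ => F y.1.1 (Nat.pair y.1.2 y.2))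
        (g := fun _ m => decide (m = 0)) ?_ ?_
      · exact Partrec₂.comp F1 (Computable.fst.comp Computable.fst)
          ((Primrec₂.natPair.to_comp).comp (Computable.snd.comp Computable.fst) Computable.snd)
      · have : Primrec fun m : ℕ => decide (m = 0) :=
          (Primrec.eq.comp Primrec.id (Primrec.const 0)).decide
        exact (this.comp Primrec.snd).to_comp
    · intro σ τ hs n m h
      rw [mem_rfind_iff] at h ⊢
      refine ⟨F2 _ _ hs _ _ h.1, fun j hj => ?_⟩
      obtain ⟨c, h1, h2⟩ := h.2 j hj
      exact ⟨c, h1, F2 _ _ hs _ _ h2⟩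
    · intro k n m h
      rw [mem_rfind_iff] at h ⊢
      refine ⟨F3 _ _ _ h.1, fun j hj => ?_⟩
      obtain ⟨c, h1, h2⟩ := h.2 j hj
      exact ⟨c, h1, F3 _ _ _ h2⟩
    · intro n m h
      simp only [mem_rfind_iff] at h ⊢
      obtain ⟨h1, h2⟩ := h
      obtain ⟨k, hk⟩ := F4 _ _ h1
      have : ∃ l, ∀ j < m, ∃ c, c ≠ 0 ∧ c ∈ F (pre A l) (Nat.pair n j) := by
        clear h1 hk
        induction m with
        | zero => exact ⟨0, by simp⟩
        | succ m ih =>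
          obtain ⟨l, hl⟩ := ih fun j hj => h2 j (by omega)
          obtain ⟨c, h3, h4⟩ := h2 m (by omega)
          obtain ⟨l', hl'⟩ := F4 _ _ h4
          refine ⟨max l l', fun j hj => ?_⟩
          rcases Nat.lt_succ_iff_lt_or_eq.1 hj with h | rfl
          · obtain ⟨c, h5, h6⟩ := hl j h
            exact ⟨c, h5, F2 _ _ (pre_mono_len A (le_max_left _ _)) _ _ h6⟩
          · exact ⟨c, h3, F2 _ _ (pre_mono_len A (le_max_right _ _)) _ _ hl'⟩
      obtain ⟨l, hl⟩ := this
      refine ⟨max k l, F2 _ _ (pre_mono_len A (le_max_left _ _)) _ _ hk, fun j hj => ?_⟩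
      obtain ⟨c, h5, h6⟩ := hl j hj
      exact ⟨c, h5, F2 _ _ (pre_mono_len A (le_max_right _ _)) _ _ h6⟩

/-- single valued -/
def SV (P : Orc → ℕ × Bool → Prop) : Prop := ∀ A n b c, P A (n, b) → P A (n, c) → b = c

theorem Red.toEO {W A : Orc} (h : Red W A) :
    ∃ P : Orc → ℕ × Bool → Prop, EO P ∧ SV P ∧ ∀ n b, W n = b ↔ P A (n, b) := by
  obtain ⟨Ψ, h1, h2, h3, h4⟩ := nf_of_recursiveIn h
  have h1' : Partrec fun x : List Bool × ℕ => Ψ x.1 x.2 := h1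
  obtain ⟨c, hc⟩ := Nat.Partrec.Code.exists_code.1 h1'
  have ev : ∀ σ n m, m ∈ Ψ σ n ↔ m ∈ c.eval (Encodable.encode (σ, n)) := by
    intro σ n m
    rw [hc]
    simp
  let v : List Bool × (ℕ × Bool) → Prop := fun x =>
    ∃ k < x.1.length + 1, Nat.Partrec.Code.evaln x.1.length c
      (Encodable.encode (x.1.take k, x.2.1)) = some x.2.2.toNat
  have hvA : ∀ B n b, (∃ k, v (pre B k, (n, b))) ↔ ∃ k, b.toNat ∈ Ψ (pre B k) n := by
    intro B n b
    have tk : ∀ k l, k ≤ l → (pre B l).take k = pre B k := by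
      intro k l h
      unfold pre
      rw [← List.map_take, List.take_range, min_eq_left h]
    constructor
    · rintro ⟨l, k, hk, he⟩
      rw [pre_length] at hk
      simp only [pre_length] at he
      rw [tk k l (by omega)] at he
      exact ⟨k, (ev _ _ _).2 (Nat.Partrec.Code.evaln_sound he)⟩
    · rintro ⟨k, hk⟩
      obtain ⟨s, hs⟩ := Nat.Partrec.Code.evaln_complete.1 ((ev _ _ _).1 hk)
      refine ⟨max k s, k, by simp [pre_length], ?_⟩
      simp only [pre_length]
      rw [tk k _ (le_max_left _ _)]
      exact Nat.Partrec.Code.evaln_mono (le_max_right _ _) hs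
  refine ⟨fun B x => ∃ k, v (pre B k, x), ⟨v, ?_, ?_, fun _ _ => Iff.rfl⟩, ?_, ?_⟩
  · have hr : PrimrecRel (fun (k : ℕ) (x : List Bool × (ℕ × Bool)) =>
        Nat.Partrec.Code.evaln x.1.length c
        (Encodable.encode (x.1.take k, x.2.1)) = some x.2.2.toNat) := by
      refine Primrec.eq.comp ?_ ?_
      · refine Nat.Partrec.Code.primrec_evaln.comp (Primrec.pair (Primrec.pair
          (Primrec.list_length.comp (Primrec.fst.comp Primrec.snd)) (Primrec.const c)) ?_)
        refine Primrec.encode.comp (Primrec.pair (Primrec.list_take.comp Primrec.fst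
          (Primrec.fst.comp Primrec.snd)) (Primrec.fst.comp (Primrec.snd.comp Primrec.snd)))
      · exact Primrec.option_some.comp ((Primrec.dom_bool Bool.toNat).comp
          (Primrec.snd.comp (Primrec.snd.comp Primrec.snd)))
    have h5 := PrimrecRel.exists_mem_list hr
    refine PrimrecPred.of_eq (PrimrecRel.comp
      (f := fun x : List Bool × (ℕ × Bool) => List.range (x.1.length + 1))
      (g := fun x => x) h5 (Primrec.list_range.comp
      (Primrec.succ.comp (Primrec.list_length.comp Primrec.fst))) Primrec.id) ?_
    intro x
    simp only [List.mem_range, v]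
  · rintro σ τ a hs ⟨k, hk, he⟩
    refine ⟨k, lt_of_lt_of_le hk (by simpa using hs.length_le), ?_⟩
    have : τ.take k = σ.take k := by
      obtain ⟨ρ, rfl⟩ := hs
      exact List.take_append_of_le_length (by simp only at hk; omega)
    simp only [this]
    exact Nat.Partrec.Code.evaln_mono hs.length_le he
  · intro B n b b' hb hb'
    rw [hvA] at hb hb'
    obtain ⟨k, hk⟩ := hb
    obtain ⟨l, hl⟩ := hb'
    have := Part.mem_unique (h2 _ _ (pre_mono_len B (le_max_left k l)) _ _ hk)
      (h2 _ _ (pre_mono_len B (le_max_right k l)) _ _ hl)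
    revert this
    cases b <;> cases b' <;> simp
  · intro n b
    change W n = b ↔ ∃ k, v (pre A k, (n, b))
    rw [hvA]
    constructor
    · rintro rfl
      exact h4 _ _ (by simp [co])
    · rintro ⟨k, hk⟩
      have := h3 _ _ _ hk
      simp only [PFun.coe_val, Part.mem_some_iff, co] at this
      revert this
      cases b <;> cases W n <;> simp

theorem RecursiveIn.of_eq {O f g : ℕ →. ℕ} (h : RecursiveIn O f) (e : ∀ n, f n = g n) :
    RecursiveIn O g := by
  have : f = g := funext e
  exact this ▸ h

theorem RecursiveIn.comp_tot {O : ℕ →. ℕ} {f g : ℕ → ℕ} (hf : RecursiveIn O f)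
    (hg : RecursiveIn O g) : RecursiveIn O (fun n => f (g n) : ℕ → ℕ) :=
  (RecursiveIn.comp hf hg).of_eq fun n => Part.bind_some _ _

theorem RecursiveIn.pair_tot {O : ℕ →. ℕ} {f g : ℕ → ℕ} (hf : RecursiveIn O f)
    (hg : RecursiveIn O g) : RecursiveIn O (fun n => Nat.pair (f n) (g n) : ℕ → ℕ) :=
  (RecursiveIn.pair hf hg).of_eq fun n => by simp [Seq.seq]

theorem RecursiveIn.prim {O : ℕ →. ℕ} {f : ℕ → ℕ} (hf : Primrec f) : RecursiveIn O f :=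
  RecursiveIn.of_partrec (Nat.Partrec.of_primrec (Primrec.nat_iff.1 hf))

/-- prefixes of the oracle are computable from the oracle -/
theorem recursiveIn_pre (A : Orc) :
    RecursiveIn (co A) (fun k => Encodable.encode (pre A k) : ℕ → ℕ) := by
  -- step function on codes
  let st : ℕ → ℕ := fun x => Encodable.encode
    (((Encodable.decode (α := List Bool) x.unpair.1).getD []) ++ [decide (x.unpair.2 = 1)])
  have hst : Primrec st := by
    refine Primrec.encode.comp (Primrec.list_append.comp ?_ ?_)
    · exact Primrec.option_getD.comp (Primrec.decode.comp (Primrec.fst.comp Primrec.unpair))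
        (Primrec.const [])
    · refine Primrec.list_cons.comp ?_ (Primrec.const [])
      exact (Primrec.eq.comp (Primrec.snd.comp Primrec.unpair) (Primrec.const 1)).decide
  have hG : RecursiveIn (co A) (fun x => st (Nat.pair x.unpair.2.unpair.2
      (co A x.unpair.2.unpair.1)) : ℕ → ℕ) := by
    refine RecursiveIn.comp_tot (RecursiveIn.prim hst) (RecursiveIn.pair_tot ?_ ?_)
    · exact RecursiveIn.prim (Primrec.snd.comp (Primrec.unpair.comp
        (Primrec.snd.comp Primrec.unpair)))
    · refine RecursiveIn.comp_tot RecursiveIn.oracle ?_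
      exact RecursiveIn.prim (Primrec.fst.comp (Primrec.unpair.comp
        (Primrec.snd.comp Primrec.unpair)))
  have hp := RecursiveIn.prec (RecursiveIn.prim (O := co A) (f := fun _ => Encodable.encode
    ([] : List Bool)) (Primrec.const _)) hG
  have h2 := RecursiveIn.comp hp (RecursiveIn.prim (O := co A) (f := fun k => Nat.pair 0 k)
    (Primrec₂.natPair.comp (Primrec.const 0) Primrec.id))
  refine h2.of_eq fun k => ?_
  simp only [PFun.coe_val, Part.bind_eq_bind, Part.bind_some, Nat.unpaired, Nat.unpair_pair]
  induction k with
  | zero => simp [pre]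
  | succ k ih =>
    change Part.bind _ _ = _
    rw [ih, Part.bind_some]
    simp only [Part.some_inj, st, Nat.unpair_pair, Encodable.encodek,
      Option.getD_some, Encodable.encode_inj]
    have : pre A (k + 1) = pre A k ++ [A k] := by simp [pre, List.range_succ]
    rw [this]
    cases h : A k <;> simp [co, h]

theorem Red.ofEO {W A : Orc} {P : Orc → ℕ × Bool → Prop} (hP : EO P)
    (h : ∀ n b, W n = b ↔ P A (n, b)) : Red W A := by
  classical
  obtain ⟨v, v1, v2, v3⟩ := hP
  -- test function on (code of prefix, (n, bit))
  let ts : ℕ → ℕ := fun x => if v ((Encodable.decode (α := List Bool) x.unpair.1).getD [],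
    (x.unpair.2.unpair.1, decide (x.unpair.2.unpair.2 = 1))) then 0 else 1
  have hts : Primrec ts := by
    refine Primrec.ite (v1.comp (Primrec.pair ?_ (Primrec.pair ?_ ?_))) (Primrec.const 0)
      (Primrec.const 1)
    · exact Primrec.option_getD.comp (Primrec.decode.comp (Primrec.fst.comp Primrec.unpair))
        (Primrec.const [])
    · exact Primrec.fst.comp (Primrec.unpair.comp (Primrec.snd.comp Primrec.unpair))
    · exact (Primrec.eq.comp (Primrec.snd.comp (Primrec.unpair.comp
        (Primrec.snd.comp Primrec.unpair))) (Primrec.const 1)).decide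
  -- search over t = pair k bit
  have hF : RecursiveIn (co A) (fun x => ts (Nat.pair (Encodable.encode (pre A x.unpair.2.unpair.1))
      (Nat.pair x.unpair.1 x.unpair.2.unpair.2)) : ℕ → ℕ) := by
    refine RecursiveIn.comp_tot (RecursiveIn.prim hts) (RecursiveIn.pair_tot ?_
      (RecursiveIn.pair_tot ?_ ?_))
    · refine RecursiveIn.comp_tot (recursiveIn_pre A) ?_
      exact RecursiveIn.prim (Primrec.fst.comp (Primrec.unpair.comp
        (Primrec.snd.comp Primrec.unpair)))
    · exact RecursiveIn.prim (Primrec.fst.comp Primrec.unpair)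
    · exact RecursiveIn.prim (Primrec.snd.comp (Primrec.unpair.comp
        (Primrec.snd.comp Primrec.unpair)))
  have hS := RecursiveIn.rfind hF
  have hO : RecursiveIn (co A) (fun t => if t.unpair.2 = 1 then 1 else 0 : ℕ → ℕ) :=
    RecursiveIn.prim (Primrec.ite (Primrec.eq.comp (Primrec.snd.comp Primrec.unpair)
      (Primrec.const 1)) (Primrec.const 1) (Primrec.const 0))
  refine (RecursiveIn.comp hO hS).of_eq fun n => ?_
  have key : ∀ t : ℕ, ts (Nat.pair (Encodable.encode (pre A t.unpair.1)) (Nat.pair n t.unpair.2)) = 0 ↔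
      v (pre A t.unpair.1, (n, decide (t.unpair.2 = 1))) := by
    intro t
    simp only [ts, Nat.unpair_pair, Encodable.encodek, Option.getD_some]
    split_ifs with hh <;> simp [hh]
  have hval : ∀ t : ℕ, v (pre A t.unpair.1, (n, decide (t.unpair.2 = 1))) →
      (if t.unpair.2 = 1 then 1 else 0) = co W n := by
    intro t ht
    have := (h n _).2 ((v3 _ _).2 ⟨_, ht⟩)
    simp only [co, this]
    split_ifs with h1 <;> simp [h1]
  obtain ⟨k, hk⟩ := (v3 _ _).1 ((h n (W n)).1 rfl)
  have hex : ∃ t : ℕ, v (pre A t.unpair.1, (n, decide (t.unpair.2 = 1))) := by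
    refine ⟨Nat.pair k (W n).toNat, ?_⟩
    simp only [Nat.unpair_pair]
    convert hk
    cases W n <;> simp
  refine Part.eq_some_iff.2 (Part.mem_bind_iff.2 ⟨Nat.find hex, ?_, ?_⟩)
  · refine Nat.mem_rfind.2 ?_
    simp only [Nat.unpair_pair, Part.map_eq_map, Part.map_some, Part.mem_some_iff]
    refine ⟨?_, fun {m} hm => ?_⟩
    · have := (key _).2 (Nat.find_spec hex)
      simp [this]
    · have := mt (key m).1 (Nat.find_min hex hm)
      simp [this]
  · refine Part.mem_some_iff.2 ?_
    exact (hval _ (Nat.find_spec hex)).symm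

theorem Red.iffEO {W A : Orc} : Red W A ↔
    ∃ P : Orc → ℕ × Bool → Prop, EO P ∧ ∀ n b, W n = b ↔ P A (n, b) :=
  ⟨fun h => let ⟨P, h1, _, h3⟩ := h.toEO; ⟨P, h1, h3⟩, fun ⟨_, h1, h2⟩ => Red.ofEO h1 h2⟩

end RRT

namespace RRT

section
variable {α : Type*} {β : Type*} [Primcodable α] [Primcodable β]

/-- uniformly computable maps on oracles -/
def CM (Θ : Orc → α → Orc) : Prop :=
  EO (fun O (x : (α × ℕ) × Bool) => Θ O x.1.1 x.1.2 = x.2)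

theorem EO.sub {P : Orc → α → Prop} (hP : EO P) {Θ : Orc → α → Orc} (hΘ : CM Θ) :
    EO (fun O a => P (Θ O a) a) := hP.osubst hΘ

theorem CM.query {Θ : Orc → α → Orc} (hΘ : CM Θ) {f : α → ℕ} {g : α → Bool} (hf : Primrec f)
    (hg : Primrec g) : EO (fun O a => Θ O a (f a) = g a) :=
  EO.comp (f := fun a => ((a, f a), g a)) hΘ ((Primrec.id.pair hf).pair hg)

def lf (O : Orc) : Orc := fun n => O (2 * n)
def rt (O : Orc) : Orc := fun n => O (2 * n + 1)

theorem lf_jn (A B : Orc) : lf (jn A B) = A := funext fun n => jn_even A B n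
theorem rt_jn (A B : Orc) : rt (jn A B) = B := funext fun n => jn_odd A B n

theorem CM.id : CM (fun O (_ : α) => O) :=
  EO.query (Primrec.snd.comp Primrec.fst) Primrec.snd

theorem CM.lf {Θ : Orc → α → Orc} (h : CM Θ) : CM (fun O a => lf (Θ O a)) := by
  refine EO.comp (f := fun x : (α × ℕ) × Bool => ((x.1.1, 2 * x.1.2), x.2)) h ?_
  refine Primrec.pair (Primrec.pair (Primrec.fst.comp Primrec.fst) ?_) Primrec.snd
  exact Primrec.nat_mul.comp (Primrec.const 2) (Primrec.snd.comp Primrec.fst)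

theorem CM.rt {Θ : Orc → α → Orc} (h : CM Θ) : CM (fun O a => rt (Θ O a)) := by
  refine EO.comp (f := fun x : (α × ℕ) × Bool => ((x.1.1, 2 * x.1.2 + 1), x.2)) h ?_
  refine Primrec.pair (Primrec.pair (Primrec.fst.comp Primrec.fst) ?_) Primrec.snd
  exact Primrec.succ.comp (Primrec.nat_mul.comp (Primrec.const 2) (Primrec.snd.comp Primrec.fst))

theorem jn_iff (A B : Orc) (n : ℕ) (b : Bool) :
    jn A B n = b ↔ (n % 2 = 0 ∧ A (n / 2) = b) ∨ (¬ n % 2 = 0 ∧ B (n / 2) = b) := by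
  unfold jn
  split_ifs with h <;> simp [h]

theorem CM.jn {Θ Θ' : Orc → α → Orc} (h : CM Θ) (h' : CM Θ') :
    CM (fun O a => jn (Θ O a) (Θ' O a)) := by
  have hd : Primrec (fun x : (α × ℕ) × Bool => ((x.1.1, x.1.2 / 2), x.2)) :=
    Primrec.pair (Primrec.pair (Primrec.fst.comp Primrec.fst)
      (Primrec.nat_div.comp (Primrec.snd.comp Primrec.fst) (Primrec.const 2))) Primrec.snd
  have hm : PrimrecPred (fun x : (α × ℕ) × Bool => x.1.2 % 2 = 0) :=
    Primrec.eq.comp (Primrec.nat_mod.comp (Primrec.snd.comp Primrec.fst) (Primrec.const 2))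
      (Primrec.const 0)
  refine EO.of_iff (((EO.prim hm).and (EO.comp h hd)).or ((EO.prim hm.not).and (EO.comp h' hd))) ?_
  intro O a
  exact jn_iff _ _ _ _

def ch (l : List ℕ) : Orc := fun n => decide (n ∈ l)

theorem primrec_mem {f : α → List ℕ} {g : α → ℕ} (hf : Primrec f) (hg : Primrec g) :
    PrimrecPred (fun a => g a ∈ f a) :=
  PrimrecPred.of_eq ((PrimrecRel.exists_mem_list (Primrec.eq (α := ℕ))).comp hf hg) (by simp)

theorem CM.ch {f : α → List ℕ} (hf : Primrec f) : CM (fun _ a => ch (f a)) := by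
  have h := primrec_mem (α := (α × ℕ) × Bool) (hf.comp (Primrec.fst.comp Primrec.fst))
    (Primrec.snd.comp Primrec.fst)
  refine EO.prim (PrimrecPred.of_eq (Primrec.eq.comp h.decide Primrec.snd) ?_)
  intro x
  rfl

theorem CM.comp {Θ : Orc → β → Orc} (h : CM Θ) {f : α → β} (hf : Primrec f) :
    CM (fun O a => Θ O (f a)) := by
  refine EO.comp (f := fun x : (α × ℕ) × Bool => ((f x.1.1, x.1.2), x.2)) h ?_
  exact Primrec.pair (Primrec.pair (hf.comp (Primrec.fst.comp Primrec.fst))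
    (Primrec.snd.comp Primrec.fst)) Primrec.snd

/-- membership in a list is decidable, and subset bounded by an oracle -/
theorem CM.listSub {Θ : Orc → α → Orc} (h : CM Θ) {f : α → List ℕ} (hf : Primrec f) :
    EO (fun O a => ∀ y ∈ f a, Θ O a y = true) :=
  EO.ball (P := fun O a y => Θ O a y = true)
    ((h.comp Primrec.fst).query (α := α × ℕ) Primrec.snd (Primrec.const true)) hf

end

theorem Red.jn {A B C : Orc} (h1 : Red A C) (h2 : Red B C) : Red (jn A B) C := by
  obtain ⟨P, p1, p2⟩ := Red.iffEO.1 h1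
  obtain ⟨Q, q1, q2⟩ := Red.iffEO.1 h2
  have hd : Primrec (fun x : ℕ × Bool => (x.1 / 2, x.2)) :=
    Primrec.pair (Primrec.nat_div.comp Primrec.fst (Primrec.const 2)) Primrec.snd
  have hm : PrimrecPred (fun x : ℕ × Bool => x.1 % 2 = 0) :=
    Primrec.eq.comp (Primrec.nat_mod.comp Primrec.fst (Primrec.const 2)) (Primrec.const 0)
  refine Red.ofEO (((EO.prim hm).and (EO.comp p1 hd)).or ((EO.prim hm.not).and (EO.comp q1 hd))) ?_
  intro n b
  rw [jn_iff, p2, q2]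

theorem Red.ofCM {Θ : Orc → Unit → Orc} (h : CM Θ) {A B : Orc} (e : Θ A () = B) : Red B A := by
  refine Red.ofEO (P := fun O (x : ℕ × Bool) => Θ O () x.1 = x.2)
    (EO.comp (f := fun x : ℕ × Bool => (((), x.1), x.2)) h ?_) ?_
  · exact Primrec.pair (Primrec.pair (Primrec.const ()) Primrec.fst) Primrec.snd
  · intro n b
    simp only [e]

theorem Red.left (A B : Orc) : Red A (RRT.jn A B) := Red.ofCM (CM.id.lf) (lf_jn A B)
theorem Red.right (A B : Orc) : Red B (RRT.jn A B) := Red.ofCM (CM.id.rt) (rt_jn A B)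

theorem red_finite_diff {A B C : Orc} (hB : Red B C) (l : List ℕ) (h : ∀ n, n ∉ l → A n = B n) :
    Red A C := by
  obtain ⟨Q, q1, q2⟩ := Red.iffEO.1 hB
  have hA : Primrec (fun n : ℕ => (l.filter (fun i => A i)).contains n) := by
    have := (primrec_mem (Primrec.const (l.filter (fun i => A i))) (Primrec.id (α := ℕ))).decide
    refine this.of_eq fun n => ?_
    simp
  refine Red.ofEO (P := fun O (x : ℕ × Bool) =>
    (x.1 ∈ l ∧ (l.filter (fun i => A i)).contains x.1 = x.2) ∨ (¬ x.1 ∈ l ∧ Q O x)) ?_ ?_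
  · have hm : PrimrecPred (fun x : ℕ × Bool => x.1 ∈ l) := primrec_mem (Primrec.const l) Primrec.fst
    exact ((EO.prim hm).and (EO.prim (Primrec.eq.comp (hA.comp Primrec.fst) Primrec.snd))).or
      ((EO.prim hm.not).and q1)
  · intro n b
    by_cases hn : n ∈ l
    · cases hh : A n <;> cases b <;> simp [hn, hh]
    · simp only [hn, not_false_eq_true, true_and, false_and, false_or]
      rw [h n hn, q2]

theorem exists_enum : ∃ P : ℕ → Orc → ℕ × Bool → Prop, (∀ s, EO (P s)) ∧
    ∀ Q : Orc → ℕ × Bool → Prop, EO Q → ∃ s, P s = Q := by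
  have h1 : {P : Orc → ℕ × Bool → Prop | EO P}.Nonempty :=
    ⟨_, EO.prim (p := fun x : ℕ × Bool => x.2 = x.2) (Primrec.eq.comp Primrec.snd Primrec.snd)⟩
  obtain ⟨P, hP⟩ := countable_EO.exists_eq_range h1
  refine ⟨P, fun s => ?_, fun Q hQ => ?_⟩
  · have : P s ∈ {P : Orc → ℕ × Bool → Prop | EO P} := hP ▸ Set.mem_range_self s
    exact this
  · have : Q ∈ {P : Orc → ℕ × Bool → Prop | EO P} := hQ
    rw [hP] at this
    exact this

theorem bool_ne {a b : Bool} (h : ¬ a = b) : b = !a := by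
  cases a <;> cases b <;> simp_all

theorem basis_step {W A : Orc} (hW : ¬ Red W A) {Q : Orc → Unit → Prop} (hQ : EO Q)
    (hI : ∃ I, ¬ Q (jn I A) ()) {P : Orc → ℕ × Bool → Prop} (hP : EO P) :
    ∃ Q' : Orc → Unit → Prop, EO Q' ∧ (∃ I, ¬ Q' (jn I A) ()) ∧
      (∀ I, ¬ Q' (jn I A) () → ¬ Q (jn I A) () ∧ ¬ ∀ n b, W n = b ↔ P (jn I A) (n, b)) := by
  by_cases h1 : ∃ n I, ¬ Q (jn I A) () ∧ ¬ P (jn I A) (n, W n)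
  · obtain ⟨n, I, h2, h3⟩ := h1
    refine ⟨fun O a => Q O a ∨ P O (n, W n), hQ.or (hP.comp (Primrec.const _)),
      ⟨I, by simp [h2, h3]⟩, fun J hJ => ?_⟩
    rw [not_or] at hJ
    exact ⟨hJ.1, fun h => hJ.2 ((h n _).1 rfl)⟩
  by_cases h2 : ∃ n, ∀ I, ¬ Q (jn I A) () → P (jn I A) (n, !(W n))
  · obtain ⟨n, h3⟩ := h2
    refine ⟨Q, hQ, hI, fun J hJ => ⟨hJ, fun h => ?_⟩⟩
    have := (h n _).2 (h3 J hJ)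
    cases hh : W n <;> simp [hh] at this
  push Not at h1 h2
  exfalso
  apply hW
  refine Red.ofEO (EO.all (P := fun O (x : ℕ × Bool) => Q O () ∨ P O x)
    ((hQ.comp (Primrec.const ())).or hP)) ?_
  intro n b
  constructor
  · rintro rfl I
    by_cases hh : Q (jn I A) ()
    · exact Or.inl hh
    · exact Or.inr (h1 n I hh)
  · intro h
    by_contra hne
    obtain ⟨I, h3, h4⟩ := h2 n
    rw [bool_ne hne] at h
    exact (h I).elim h3 h4

theorem isClosed_class {Q : Orc → Unit → Prop} (hQ : EO Q) (A : Orc) :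
    IsClosed {I : Orc | ¬ Q (jn I A) ()} := by
  have : {I : Orc | ¬ Q (jn I A) ()} = {I : Orc | Q (jn I A) ()}ᶜ := rfl
  rw [this, isClosed_compl_iff, isOpen_iff_eventually]
  intro I hI
  obtain ⟨k, hk⟩ := hQ.use hI
  filter_upwards [pre_cont k I] with J hJ
  exact hk _ (pre_jn_of_pre hJ)

theorem basis {W A : Orc} (hW : ¬ Red W A) {Q : Orc → Unit → Prop} (hQ : EO Q)
    (hI : ∃ I, ¬ Q (jn I A) ()) : ∃ I, ¬ Q (jn I A) () ∧ ¬ Red W (jn I A) := by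
  obtain ⟨P, hP, hall⟩ := exists_enum
  let T := {Q : Orc → Unit → Prop // EO Q ∧ ∃ I, ¬ Q (jn I A) ()}
  have step : ∀ s (t : T), ∃ t' : T, ∀ I, ¬ t'.1 (jn I A) () →
      ¬ t.1 (jn I A) () ∧ ¬ ∀ n b, W n = b ↔ P s (jn I A) (n, b) := by
    intro s t
    obtain ⟨Q', a, b, c⟩ := basis_step hW t.2.1 t.2.2 (hP s)
    exact ⟨⟨Q', a, b⟩, c⟩
  choose nx hnx using step
  let seq : ℕ → T := fun s => Nat.rec ⟨Q, hQ, hI⟩ (fun s t => nx s t) s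
  have hc := IsCompact.nonempty_iInter_of_sequence_nonempty_isCompact_isClosed
    (fun s => {I : Orc | ¬ (seq s).1 (jn I A) ()})
    (fun s I h => (hnx s (seq s) I h).1) (fun s => (seq s).2.2)
    (isClosed_class (seq 0).2.1 A).isCompact (fun s => isClosed_class (seq s).2.1 A)
  obtain ⟨I, hI⟩ := hc
  rw [Set.mem_iInter] at hI
  refine ⟨I, hI 0, fun h => ?_⟩
  obtain ⟨R, r1, r2⟩ := Red.iffEO.1 h
  obtain ⟨s, rfl⟩ := hall R r1
  exact (hnx s (seq s) I (hI (s + 1))).2 r2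

theorem lemmaD {W A : Orc} (hW : ¬ Red W A) {U : Orc → ℕ × Bool → Prop} (hU : EO U) :
    (∃ n, ∀ I, U (jn I A) (n, !(W n))) ∨
    (∃ n I, ¬ U (jn I A) (n, W n) ∧ ¬ Red W (jn I A)) := by
  by_contra hc
  push Not at hc
  obtain ⟨h1, h2⟩ := hc
  have h3 : ∀ n I, U (jn I A) (n, W n) := by
    intro n
    by_contra hh
    push Not at hh
    obtain ⟨I, a, b⟩ := basis hW (Q := fun O _ => U O (n, W n)) (hU.comp (Primrec.const _)) hh
    exact b (h2 n I a)
  apply hW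
  refine Red.ofEO (EO.all hU) ?_
  intro n b
  constructor
  · rintro rfl
    exact h3 n
  · intro h
    by_contra hne
    rw [bool_ne hne] at h
    obtain ⟨I, h4⟩ := h1 n
    exact h4 (h I)

end RRT

namespace RRT

def Inf (X : Orc) : Prop := ∀ m, ∃ n, m ≤ n ∧ X n = true
def Sub (X Y : Orc) : Prop := ∀ n, X n = true → Y n = true

def cut (R : Orc) (m : ℕ) : Orc := fun n => R n && decide (m ≤ n)

theorem cut_iff {R : Orc} {m n : ℕ} : cut R m n = true ↔ R n = true ∧ m ≤ n := by simp [cut]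

theorem inf_cut {R : Orc} (h : Inf R) (m : ℕ) : Inf (cut R m) := fun k => by
  obtain ⟨n, h1, h2⟩ := h (max m k)
  exact ⟨n, le_trans (le_max_right _ _) h1, cut_iff.2 ⟨h2, le_trans (le_max_left _ _) h1⟩⟩

theorem sub_cut (R : Orc) (m : ℕ) : Sub (cut R m) R := fun _ h => (cut_iff.1 h).1

theorem red_cut {R C : Orc} (h : Red R C) (m : ℕ) : Red (cut R m) C :=
  red_finite_diff h (List.range m) fun n hn => by
    have : m ≤ n := by simpa using hn
    simp [cut, this]

/-- forcing data -/
structure Frame where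
  Good : Bool → Orc → List ℕ → Prop
  Bd : Orc → Prop
  Lk : Orc → (Bool → List ℕ) → ℕ → Prop
  goodEO : ∀ j, EO (fun I E => Good j I E)
  mono : ∀ j I E E', (∀ x ∈ E', x ∈ E) → Good j I E → Good j I E'
  bdEO : EO (fun I (_ : Unit) => ¬ Bd I)
  lkEO : ∀ F, EO (fun I y => ¬ Lk I F y)

/-- the enumeration predicate of a forcing step -/
def Frame.U (A : Frame) (F : Bool → List ℕ) (P : Bool → Orc → ℕ × Bool → Prop)
    (O : Orc) (x : ℕ × Bool) : Prop :=
  ¬ A.Bd (lf O) ∨ (∃ y : ℕ, lf (rt O) y = true ∧ ¬ A.Lk (lf O) F y) ∨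
  ∃ j : Bool, ∃ E : List ℕ, (∀ y ∈ E, lf (rt O) y = true) ∧ A.Good j (lf O) (F j ++ E) ∧
    P j (jn (ch (F j ++ E)) (rt (rt O))) x

theorem Frame.U_EO (A : Frame) (F : Bool → List ℕ) {P : Bool → Orc → ℕ × Bool → Prop}
    (hP : ∀ j, EO (P j)) : EO (A.U F P) := by
  have key : ∀ j, EO (fun (O : Orc) (x : ℕ × Bool) => ∃ E : List ℕ,
      (∀ y ∈ E, lf (rt O) y = true) ∧ A.Good j (lf O) (F j ++ E) ∧
      P j (jn (ch (F j ++ E)) (rt (rt O))) x) := by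
    intro j
    have hE : Primrec (fun x : (ℕ × Bool) × List ℕ => F j ++ x.2) :=
      Primrec.list_append.comp (Primrec.const _) Primrec.snd
    refine EO.ex (α := ℕ × Bool) (β := List ℕ) (EO.and ?_ (EO.and ?_ ?_))
    · exact (CM.id.rt.lf).listSub Primrec.snd
    · exact EO.sub (P := fun I (x : (ℕ × Bool) × List ℕ) => A.Good j I (F j ++ x.2))
        ((A.goodEO j).comp hE) CM.id.lf
    · exact EO.sub (P := fun I (x : (ℕ × Bool) × List ℕ) => P j I x.1)
        ((hP j).comp Primrec.fst) (Θ := fun O x => jn (ch (F j ++ x.2)) (rt (rt O)))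
        ((CM.ch hE).jn CM.id.rt.rt)
  refine EO.of_iff (P := fun O x => ¬ A.Bd (lf O) ∨
    (∃ y : ℕ, lf (rt O) y = true ∧ ¬ A.Lk (lf O) F y) ∨ ((∃ E : List ℕ,
      (∀ y ∈ E, lf (rt O) y = true) ∧ A.Good false (lf O) (F false ++ E) ∧
      P false (jn (ch (F false ++ E)) (rt (rt O))) x) ∨ (∃ E : List ℕ,
      (∀ y ∈ E, lf (rt O) y = true) ∧ A.Good true (lf O) (F true ++ E) ∧
      P true (jn (ch (F true ++ E)) (rt (rt O))) x)))
    (EO.or ?_ (EO.or ?_ ((key false).or (key true)))) ?_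
  · exact EO.sub (P := fun I (_ : ℕ × Bool) => ¬ A.Bd I) (A.bdEO.comp (Primrec.const ())) CM.id.lf
  · refine EO.ex (α := ℕ × Bool) (β := ℕ) (EO.and ?_ ?_)
    · exact CM.query (CM.id.rt.lf) Primrec.snd (Primrec.const true)
    · exact EO.sub (P := fun I (x : (ℕ × Bool) × ℕ) => ¬ A.Lk I F x.2)
        ((A.lkEO F).comp Primrec.snd) CM.id.lf
  · intro O x
    unfold Frame.U
    rw [Bool.exists_bool]

structure Frame.Hyp (A : Frame) (W Z C I0 : Orc) (F0 : Bool → List ℕ) (D : ℕ → Orc → Prop) :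
    Prop where
  bd : A.Bd I0
  good0 : ∀ j, A.Good j I0 (F0 j)
  look : ∀ F : Bool → List ℕ, (∀ j, A.Good j I0 (F j)) → (∀ j, ∀ x ∈ F j, x ∈ F0 j ∨ C x = true) →
    ∃ m, ∀ y, m ≤ y → C y = true → A.Lk I0 F y
  grow : ∀ (F : Bool → List ℕ) (R : Orc), (∀ j, A.Good j I0 (F j)) →
    (∀ j, ∀ x ∈ F j, x ∈ F0 j ∨ C x = true) → Inf R → Sub R C → ¬ Red W (jn R Z) →
    (∀ y, R y = true → A.Lk I0 F y) →
    ∀ (j : Bool) (m : ℕ), ∃ y, m ≤ y ∧ R y = true ∧ A.Good j I0 (y :: F j)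
  hook : ∀ s R, Inf R → Sub R C → ¬ Red W (jn R Z) →
    ∃ R', Sub R' R ∧ Inf R' ∧ ¬ Red W (jn R' Z) ∧ D s R'
  weak : ∀ (I R Z' : Orc) (F : Bool → List ℕ), A.Bd I → Inf R → Sub R C → Red I Z' → Red R Z' →
    ¬ Red W Z' → (∀ y, R y = true → A.Lk I F y) →
    ∃ j X, Sub X R ∧ Inf X ∧ ¬ Red W (jn X Z') ∧
      ∀ E : List ℕ, (∀ x ∈ E, X x = true) → A.Good j I (F j ++ E)

structure Frame.Cond (A : Frame) (W Z C I0 : Orc) (F0 F : Bool → List ℕ) (R : Orc) : Prop where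
  good : ∀ j, A.Good j I0 (F j)
  mem : ∀ j, ∀ x ∈ F j, x ∈ F0 j ∨ C x = true
  inf : Inf R
  sub : Sub R C
  avoid : ¬ Red W (jn R Z)
  lk : ∀ y, R y = true → A.Lk I0 F y

def Ext (F : Bool → List ℕ) (R : Orc) (F' : Bool → List ℕ) (R' : Orc) : Prop :=
  (∀ j, ∀ x ∈ F j, x ∈ F' j) ∧ (∀ j, ∀ x ∈ F' j, x ∈ F j ∨ R x = true) ∧ Sub R' R

theorem Ext.trans {F F' F'' : Bool → List ℕ} {R R' R'' : Orc} (h : Ext F R F' R')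
    (h' : Ext F' R' F'' R'') : Ext F R F'' R'' := by
  refine ⟨fun j x hx => h'.1 j x (h.1 j x hx), fun j x hx => ?_, fun n hn => h.2.2 n (h'.2.2 n hn)⟩
  rcases h'.2.1 j x hx with h1 | h1
  · exact h.2.1 j x h1
  · exact Or.inr (h.2.2 x h1)

/-- extend one side by a finite set and cut the reservoir -/
theorem Frame.extend {A : Frame} {W Z C I0 : Orc} {F0 F : Bool → List ℕ} {R : Orc}
    {D : ℕ → Orc → Prop}
    (H : A.Hyp W Z C I0 F0 D) (h : A.Cond W Z C I0 F0 F R) (j : Bool) (E : List ℕ)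
    (hE : ∀ x ∈ E, R x = true) (hg : A.Good j I0 (F j ++ E)) (k : ℕ) :
    ∃ F' R', A.Cond W Z C I0 F0 F' R' ∧ Ext F R F' R' ∧ F' j = F j ++ E ∧
      ∀ y, R' y = true → k ≤ y := by
  have hF' : ∀ i, Function.update F j (F j ++ E) i = F j ++ E ∧ i = j ∨
      Function.update F j (F j ++ E) i = F i := by
    intro i
    by_cases hi : i = j
    · subst hi; simp
    · simp [hi]
  have hgood : ∀ i, A.Good i I0 (Function.update F j (F j ++ E) i) := by
    intro i
    rcases hF' i with ⟨h1, h2⟩ | h1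
    · rw [h1, h2]; exact hg
    · rw [h1]; exact h.good i
  have hmem : ∀ i, ∀ x ∈ Function.update F j (F j ++ E) i, x ∈ F i ∨ R x = true := by
    intro i x hx
    rcases hF' i with ⟨h1, h2⟩ | h1
    · rw [h1] at hx
      subst h2
      exact (List.mem_append.1 hx).imp id (hE x)
    · rw [h1] at hx; exact Or.inl hx
  have hmem' : ∀ i, ∀ x ∈ Function.update F j (F j ++ E) i, x ∈ F0 i ∨ C x = true := by
    intro i x hx
    rcases hmem i x hx with h1 | h1
    · exact h.mem i x h1
    · exact Or.inr (h.sub x h1)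
  obtain ⟨m, hm⟩ := H.look _ hgood hmem'
  refine ⟨Function.update F j (F j ++ E), cut R (max m k), ⟨hgood, hmem', inf_cut h.inf _,
    fun n hn => h.sub n (sub_cut _ _ n hn), fun hr => h.avoid (hr.trans ?_), fun y hy => ?_⟩,
    ⟨?_, hmem, sub_cut _ _⟩, ?_, fun y hy => ?_⟩
  · exact Red.jn (red_cut (Red.left _ _) _) (Red.right _ _)
  · have := cut_iff.1 hy
    exact hm y (le_trans (le_max_left _ _) this.2) (h.sub y this.1)
  · intro i x hx
    rcases hF' i with ⟨h1, h2⟩ | h1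
    · rw [h1]; subst h2; simp [hx]
    · rw [h1]; exact hx
  · simp
  · exact le_trans (le_max_right _ _) (cut_iff.1 hy).2

theorem pre_jn_agree {A B Z : Orc} {k : ℕ} (h : ∀ m < k, A m = B m) :
    pre (jn A Z) k = pre (jn B Z) k := pre_jn_congr h

/-- requirement step -/
theorem Frame.require {A : Frame} {W Z C I0 : Orc} {F0 F : Bool → List ℕ} {R : Orc}
    {D : ℕ → Orc → Prop}
    (H : A.Hyp W Z C I0 F0 D) (h : A.Cond W Z C I0 F0 F R) {P : Bool → Orc → ℕ × Bool → Prop}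
    (hP : ∀ j, EO (P j)) :
    ∃ F' R', A.Cond W Z C I0 F0 F' R' ∧ Ext F R F' R' ∧ ∃ j, ∀ G : Orc,
      (∀ x ∈ F' j, G x = true) → (∀ x, G x = true → x ∈ F' j ∨ R' x = true) →
      ¬ ∀ n b, W n = b ↔ P j (jn G Z) (n, b) := by
  rcases lemmaD h.avoid (A.U_EO F hP) with ⟨n, hn⟩ | ⟨n, I, hn, hr⟩
  · have := hn I0
    unfold Frame.U at this
    rw [lf_jn, rt_jn, lf_jn, rt_jn] at this
    rcases this with h1 | ⟨y, h1, h2⟩ | ⟨j, E, h1, h2, h3⟩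
    · exact absurd H.bd h1
    · exact absurd (h.lk y h1) h2
    · obtain ⟨k, hk⟩ := (hP j).use h3
      obtain ⟨F', R', h4, h5, h6, h7⟩ := Frame.extend H h j E h1 h2 k
      refine ⟨F', R', h4, h5, j, fun G hG hG' hc => ?_⟩
      have : P j (jn G Z) (n, !(W n)) := by
        refine hk _ (pre_jn_congr fun m hm => ?_)
        rw [← h6]
        by_cases hmem : m ∈ F' j
        · simp [hG m hmem, ch, hmem]
        · have h8 : ¬ G m = true := by
            intro h9
            rcases hG' m h9 with h10 | h10
            · exact hmem h10
            · exact absurd (h7 m h10) (by omega)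
          simpa [ch, hmem] using h8
      have := (hc n _).2 this
      cases hh : W n <;> simp [hh] at this
  · have hU := hn
    unfold Frame.U at hU
    rw [lf_jn, rt_jn, lf_jn, rt_jn] at hU
    push Not at hU
    obtain ⟨hb, hl, hU⟩ := hU
    obtain ⟨j, X, h1, h2, h3, h4⟩ := H.weak I R (jn I (jn R Z)) F hb h.inf h.sub (Red.left _ _)
      ((Red.left _ _).trans (Red.right _ _)) hr hl
    refine ⟨F, X, ⟨h.good, h.mem, h2, fun n hn => h.sub n (h1 n hn), fun hh => h3 (hh.trans ?_),
      fun y hy => h.lk y (h1 y hy)⟩, ⟨fun _ _ hx => hx, fun _ _ hx => Or.inl hx, h1⟩, j,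
      fun G hG hG' hc => ?_⟩
    · exact Red.jn (Red.left _ _) (((Red.right _ _).trans (Red.right _ _)).trans (Red.right _ _))
    · obtain ⟨k, hk⟩ := (hP j).use ((hc n _).1 rfl)
      let E := (List.range k).filter (fun x => X x && G x)
      have hEX : ∀ x ∈ E, X x = true := by
        intro x hx
        simp only [E, List.mem_filter, Bool.and_eq_true] at hx
        exact hx.2.1
      refine hU j E (fun y hy => h1 y (hEX y hy)) (h4 E hEX) (hk _ (pre_jn_congr fun m hm => ?_))
      have e : m ∈ F j ++ E ↔ G m = true := by
        simp only [E, List.mem_append, List.mem_filter, List.mem_range, Bool.and_eq_true]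
        constructor
        · rintro (h5 | h5)
          · exact hG m h5
          · exact h5.2.2
        · intro h5
          rcases hG' m h5 with h6 | h6
          · exact Or.inl h6
          · exact Or.inr ⟨hm, h6, h5⟩
      by_cases h5 : G m = true
      · rw [h5]; simp [ch, e.2 h5]
      · have h6 := mt e.1 h5
        rw [Bool.not_eq_true] at h5
        rw [h5]; simpa [ch] using h6

theorem Frame.grow1 {A : Frame} {W Z C I0 : Orc} {F0 F : Bool → List ℕ} {R : Orc}
    {D : ℕ → Orc → Prop}
    (H : A.Hyp W Z C I0 F0 D) (h : A.Cond W Z C I0 F0 F R) (j : Bool) (m : ℕ) :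
    ∃ F' R', A.Cond W Z C I0 F0 F' R' ∧ Ext F R F' R' ∧ ∃ y, m ≤ y ∧ R y = true ∧ y ∈ F' j := by
  obtain ⟨y, h1, h2, h3⟩ := H.grow F R h.good h.mem h.inf h.sub h.avoid h.lk j m
  obtain ⟨F', R', h4, h5, h6, h7⟩ := Frame.extend H h j [y] (by simpa using h2)
    (A.mono _ _ _ _ (by intro x; simp; tauto) h3) 0
  exact ⟨F', R', h4, h5, y, h1, h2, by rw [h6]; simp⟩

theorem Frame.step {A : Frame} {W Z C I0 : Orc} {F0 F : Bool → List ℕ} {R : Orc}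
    {D : ℕ → Orc → Prop}
    (H : A.Hyp W Z C I0 F0 D) (h : A.Cond W Z C I0 F0 F R) {P : Bool → Orc → ℕ × Bool → Prop}
    (hP : ∀ j, EO (P j)) (s : ℕ) :
    ∃ F' R', A.Cond W Z C I0 F0 F' R' ∧ Ext F R F' R' ∧ (∃ j, ∀ G : Orc,
      (∀ x ∈ F' j, G x = true) → (∀ x, G x = true → x ∈ F' j ∨ R' x = true) →
      ¬ ∀ n b, W n = b ↔ P j (jn G Z) (n, b)) ∧
      (∀ j, ∃ y, s ≤ y ∧ C y = true ∧ y ∈ F' j) ∧ ∃ R'', D s R'' ∧ Sub R' R'' := by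
  obtain ⟨F1, R1, c1, e1, y1, g1, r1, m1⟩ := Frame.grow1 H h false s
  obtain ⟨F2, R2, c2, e2, y2, g2, r2, m2⟩ := Frame.grow1 H c1 true s
  obtain ⟨R3, s3, i3, n3, d3⟩ := H.hook s R2 c2.inf c2.sub c2.avoid
  have c3 : A.Cond W Z C I0 F0 F2 R3 := ⟨c2.good, c2.mem, i3, fun n hn => c2.sub n (s3 n hn), n3,
    fun y hy => c2.lk y (s3 y hy)⟩
  have e3 : Ext F2 R2 F2 R3 := ⟨fun _ _ hx => hx, fun _ _ hx => Or.inl hx, s3⟩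
  obtain ⟨F4, R4, c4, e4, h4⟩ := Frame.require H c3 hP
  refine ⟨F4, R4, c4, e1.trans (e2.trans (e3.trans e4)), h4, fun j => ?_, R3, d3, e4.2.2⟩
  cases j
  · exact ⟨y1, g1, h.sub _ r1, e4.1 _ _ (e2.1 _ _ m1)⟩
  · exact ⟨y2, g2, c1.sub _ r2, e4.1 _ _ m2⟩

theorem Frame.main {A : Frame} {W Z C I0 : Orc} {F0 : Bool → List ℕ} {D : ℕ → Orc → Prop}
    (H : A.Hyp W Z C I0 F0 D) (hC : Inf C) (hW : ¬ Red W (jn C Z)) :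
    ∃ j X, Sub X C ∧ Inf X ∧ ¬ Red W (jn X Z) ∧
      (∀ E : List ℕ, (∀ x ∈ E, X x = true) → A.Good j I0 (F0 j ++ E)) ∧
      ∀ s, ∃ R, D s R ∧ ∃ m, ∀ n, m ≤ n → X n = true → R n = true := by
  classical
  obtain ⟨P, hP, hall⟩ := exists_enum
  let T := {x : (Bool → List ℕ) × Orc // A.Cond W Z C I0 F0 x.1 x.2}
  let PP : ℕ → Bool → Orc → ℕ × Bool → Prop := fun s j => P (bif j then s.unpair.2 else s.unpair.1)
  have hst : ∀ s (t : T), ∃ t' : T, Ext t.1.1 t.1.2 t'.1.1 t'.1.2 ∧ (∃ j, ∀ G : Orc,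
      (∀ x ∈ t'.1.1 j, G x = true) → (∀ x, G x = true → x ∈ t'.1.1 j ∨ t'.1.2 x = true) →
      ¬ ∀ n b, W n = b ↔ PP s j (jn G Z) (n, b)) ∧
      (∀ j, ∃ y, s ≤ y ∧ C y = true ∧ y ∈ t'.1.1 j) ∧ ∃ R'', D s R'' ∧ Sub t'.1.2 R'' := by
    intro s t
    obtain ⟨F', R', c, h⟩ := Frame.step H t.2 (P := PP s) (fun j => hP _) s
    exact ⟨⟨(F', R'), c⟩, h⟩
  choose nx hnx using hst
  obtain ⟨m0, hm0⟩ := H.look F0 H.good0 (fun j x hx => Or.inl hx)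
  have c0 : A.Cond W Z C I0 F0 F0 (cut C m0) := by
    refine ⟨H.good0, fun j x hx => Or.inl hx, inf_cut hC _, sub_cut _ _, fun h => hW (h.trans ?_),
      fun y hy => hm0 y (cut_iff.1 hy).2 (cut_iff.1 hy).1⟩
    exact Red.jn (red_cut (Red.left _ _) _) (Red.right _ _)
  let seq : ℕ → T := fun s => Nat.rec ⟨(F0, cut C m0), c0⟩ (fun s t => nx s t) s
  have hs : ∀ s, seq (s + 1) = nx s (seq s) := fun s => rfl
  have hext : ∀ s d, Ext (seq s).1.1 (seq s).1.2 (seq (s + d)).1.1 (seq (s + d)).1.2 := by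
    intro s d
    induction d with
    | zero => exact ⟨fun _ _ hx => hx, fun _ _ hx => Or.inl hx, fun _ h => h⟩
    | succ d ih => exact ih.trans (hnx (s + d) (seq (s + d))).1
  have hmonoF : ∀ s t, s ≤ t → ∀ j, ∀ x ∈ (seq s).1.1 j, x ∈ (seq t).1.1 j := by
    intro s t hst
    obtain ⟨d, rfl⟩ := Nat.exists_eq_add_of_le hst
    exact (hext s d).1
  let G : Bool → Orc := fun j x => decide (∃ s, x ∈ (seq s).1.1 j)
  have hG : ∀ j x, G j x = true ↔ ∃ s, x ∈ (seq s).1.1 j := fun j x => by simp [G]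
  have hG1 : ∀ s j, ∀ x ∈ (seq s).1.1 j, G j x = true := fun s j x hx => (hG j x).2 ⟨s, hx⟩
  have hG2 : ∀ s j x, G j x = true → x ∈ (seq s).1.1 j ∨ (seq s).1.2 x = true := by
    intro s j x hx
    obtain ⟨t, ht⟩ := (hG j x).1 hx
    rcases le_total s t with h | h
    · obtain ⟨d, rfl⟩ := Nat.exists_eq_add_of_le h
      exact (hext s d).2.1 j x ht
    · exact Or.inl (hmonoF t s h j x ht)
  have hav : ∃ j, ¬ Red W (jn (G j) Z) := by
    by_contra hc
    push Not at hc
    obtain ⟨Q0, a0, b0⟩ := Red.iffEO.1 (hc false)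
    obtain ⟨Q1, a1, b1⟩ := Red.iffEO.1 (hc true)
    obtain ⟨s0, rfl⟩ := hall Q0 a0
    obtain ⟨s1, rfl⟩ := hall Q1 a1
    obtain ⟨-, ⟨j, hj⟩, -⟩ := hnx (Nat.pair s0 s1) (seq (Nat.pair s0 s1))
    refine hj (G j) (hG1 (Nat.pair s0 s1 + 1) j) (hG2 (Nat.pair s0 s1 + 1) j) ?_
    cases j
    · simpa [PP] using b0
    · simpa [PP] using b1
  obtain ⟨j, hj⟩ := hav
  refine ⟨j, fun n => G j n && C n, fun n hn => ?_, fun m => ?_, fun hr => hj (hr.trans ?_),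
    fun E hE => ?_, fun s => ?_⟩
  · simp only [Bool.and_eq_true] at hn
    exact hn.2
  · obtain ⟨y, h1, h2, h3⟩ := (hnx m (seq m)).2.2.1 j
    refine ⟨y, h1, ?_⟩
    simp only [Bool.and_eq_true]
    exact ⟨hG1 (m + 1) j y h3, h2⟩
  · refine Red.jn (red_finite_diff (Red.left (G j) Z) (F0 j) fun n hn => ?_) (Red.right _ _)
    cases hh : G j n
    · simp
    · rcases hG2 0 j n hh with h1 | h1
      · exact absurd h1 hn
      · simpa using (sub_cut _ _ n h1)
  · have : ∃ s, ∀ x ∈ F0 j ++ E, x ∈ (seq s).1.1 j := by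
      induction E with
      | nil => exact ⟨0, fun x hx => by rw [List.append_nil] at hx; exact hx⟩
      | cons e E ih =>
        obtain ⟨s, hs⟩ := ih fun x hx => hE x (List.mem_cons_of_mem _ hx)
        have he := hE e (by simp)
        simp only [Bool.and_eq_true] at he
        obtain ⟨t, ht⟩ := (hG j e).1 he.1
        refine ⟨max s t, fun x hx => ?_⟩
        simp only [List.mem_append, List.mem_cons] at hx
        rcases hx with hx | rfl | hx
        · exact hmonoF _ _ (le_max_left _ _) _ _ (hs x (by simp [hx]))
        · exact hmonoF _ _ (le_max_right _ _) _ _ ht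
        · exact hmonoF _ _ (le_max_left _ _) _ _ (hs x (by simp [hx]))
    obtain ⟨s, hs⟩ := this
    exact A.mono _ _ _ _ hs ((seq s).2.good j)
  · obtain ⟨R, h1, h2⟩ := (hnx s (seq s)).2.2.2
    refine ⟨R, h1, ((seq (s + 1)).1.1 j).sum + 1, fun n hn hx => ?_⟩
    simp only [Bool.and_eq_true] at hx
    rcases hG2 (s + 1) j n hx.1 with h3 | h3
    · have := List.le_sum_of_mem h3
      omega
    · exact h2 n h3

end RRT

namespace RRT

theorem EO_const {α : Type*} [Primcodable α] (p : Prop) : EO (fun _ (_ : α) => p) := by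
  by_cases hp : p
  · refine EO.of_iff (EO.prim (p := fun _ : α => (0 : ℕ) = 0)
      (Primrec.eq.comp (Primrec.const 0) (Primrec.const 0))) (by simp [hp])
  · refine EO.of_iff (EO.prim (p := fun _ : α => (0 : ℕ) = 1)
      (Primrec.eq.comp (Primrec.const 0) (Primrec.const 1))) (by simp [hp])

def rtFrame : Frame where
  Good j I E := ∀ x ∈ E, I x = j
  Bd _ := True
  Lk I F _ := ∀ j, ∀ x ∈ F j, I x = j
  goodEO j := EO.ball (P := fun I (_ : List ℕ) x => I x = j)
    (EO.query Primrec.snd (Primrec.const j)) Primrec.id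
  mono j I E E' h hg := fun x hx => hg x (h x hx)
  bdEO := EO_const _
  lkEO F := by
    refine EO.of_iff (EO.or
      (EO.bex (P := fun I (_ : ℕ) x => I x = true) (EO.query Primrec.snd (Primrec.const true))
        (Primrec.const (F false)))
      (EO.bex (P := fun I (_ : ℕ) x => I x = false) (EO.query Primrec.snd (Primrec.const false))
        (Primrec.const (F true)))) ?_
    intro I y
    simp only [Bool.forall_bool, not_and_or, not_forall, Bool.not_eq_true, Bool.not_eq_false,
      exists_prop]

theorem red_sep {R I A : Orc} (hR : Red R A) (hI : Red I A) (j : Bool) :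
    Red (fun n => R n && (I n == j)) A := by
  refine Red.trans ?_ (hR.jn hI)
  have key : EO (fun O (x : ℕ × Bool) => (O (2 * x.1) = true ∧ O (2 * x.1 + 1) = j ∧ x.2 = true) ∨
    ((O (2 * x.1) = false ∨ O (2 * x.1 + 1) = !j) ∧ x.2 = false)) := by
    have h0 : Primrec (fun x : ℕ × Bool => 2 * x.1) :=
      Primrec.nat_mul.comp (Primrec.const 2) Primrec.fst
    have h1 : Primrec (fun x : ℕ × Bool => 2 * x.1 + 1) := Primrec.succ.comp h0
    refine EO.or (EO.and (EO.query h0 (Primrec.const _)) (EO.and (EO.query h1 (Primrec.const _))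
      (EO.prim (Primrec.eq.comp Primrec.snd (Primrec.const _)))))
      (EO.and (EO.or (EO.query h0 (Primrec.const _)) (EO.query h1 (Primrec.const _)))
      (EO.prim (Primrec.eq.comp Primrec.snd (Primrec.const _))))
  refine Red.ofEO key fun n b => ?_
  simp only [jn_even, jn_odd]
  cases R n <;> cases I n <;> cases j <;> cases b <;> simp

theorem inf_split {R : Orc} (h : Inf R) (I : Orc) : ∃ j, Inf (fun n => R n && (I n == j)) := by
  by_contra hc
  push Not at hc
  have h0 := hc false
  have h1 := hc true
  unfold Inf at h0 h1
  push Not at h0 h1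
  obtain ⟨m0, h0⟩ := h0
  obtain ⟨m1, h1⟩ := h1
  obtain ⟨n, hn, hr⟩ := h (max m0 m1)
  have a := h0 n (le_trans (le_max_left _ _) hn)
  have b := h1 n (le_trans (le_max_right _ _) hn)
  cases hI : I n <;> simp [hr, hI] at a b

theorem rt12 {W Z C : Orc} (hC : Inf C) (hW : ¬ Red W (jn C Z)) (S : Orc) :
    ∃ j X, Sub X C ∧ Inf X ∧ ¬ Red W (jn X Z) ∧ ∀ y, X y = true → S y = j := by
  by_contra hc
  push Not at hc
  have H : rtFrame.Hyp W Z C S (fun _ => []) (fun _ _ => True) := by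
    refine ⟨trivial, fun j x hx => by simp at hx, fun F hF _ => ⟨0, fun _ _ _ => hF⟩, ?_,
      fun s R h1 h2 h3 => ⟨R, fun _ h => h, h1, h3, trivial⟩, ?_⟩
    · intro F R hg hm hi hs ha hl j m
      by_contra hno
      push Not at hno
      obtain ⟨y, hy, hy'⟩ := hc (!j) (cut R m) (fun n hn => hs n (sub_cut _ _ n hn)) (inf_cut hi m)
        (fun hr => ha (hr.trans (Red.jn (red_cut (Red.left _ _) _) (Red.right _ _))))
      obtain ⟨h1, h2⟩ := cut_iff.1 hy
      refine hno y h2 h1 ?_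
      intro x hx
      rcases List.mem_cons.1 hx with rfl | hx
      · cases hS : S x <;> cases j <;> simp [hS] at hy' ⊢
      · exact hg j x hx
    · intro I R Z' F _ hi hs hI hR ha hl
      obtain ⟨j, hj⟩ := inf_split hi I
      refine ⟨j, _, fun n hn => ?_, hj, fun hr => ha (hr.trans
        (Red.jn (red_sep hR hI j) (Red.refl _))), fun E hE x hx => ?_⟩
      · simp only [Bool.and_eq_true] at hn
        exact hn.1
      · rcases List.mem_append.1 hx with hx | hx
        · obtain ⟨y, -, hy⟩ := hi 0
          exact hl y hy j x hx
        · have := hE x hx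
          simp only [Bool.and_eq_true, beq_iff_eq] at this
          exact this.2
  obtain ⟨j, X, h1, h2, h3, h4, -⟩ := Frame.main H hC hW
  obtain ⟨y, hy, hy'⟩ := hc j X h1 h2 h3
  exact hy' (h4 [y] (by simpa using hy) y (by simp))

def trivFrame : Frame where
  Good _ _ _ := True
  Bd _ := True
  Lk _ _ _ := True
  goodEO _ := EO_const _
  mono _ _ _ _ _ h := h
  bdEO := EO_const _
  lkEO _ := EO_const _

theorem coh {W Z C : Orc} (hC : Inf C) (hW : ¬ Red W (jn C Z)) (S : ℕ → Orc) :
    ∃ X, Sub X C ∧ Inf X ∧ ¬ Red W (jn X Z) ∧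
      ∀ s, ∃ j m, ∀ n, m ≤ n → X n = true → S s n = j := by
  have H : trivFrame.Hyp W Z C Z (fun _ => []) (fun s R => ∃ j, ∀ y, R y = true → S s y = j) := by
    refine ⟨trivial, fun j => trivial, fun F _ _ => ⟨0, fun _ _ _ => trivial⟩, ?_, ?_, ?_⟩
    · intro F R hg hm hi hs ha hl j m
      obtain ⟨y, h1, h2⟩ := hi m
      exact ⟨y, h1, h2, trivial⟩
    · intro s R hi hs ha
      obtain ⟨j, X, h1, h2, h3, h4⟩ := rt12 hi ha (S s)
      exact ⟨X, h1, h2, h3, j, h4⟩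
    · intro I R Z' F _ hi hs hI hR ha hl
      exact ⟨true, R, fun _ h => h, hi, fun hr => ha (hr.trans (Red.jn hR (Red.refl _))),
        fun _ _ => trivial⟩
  obtain ⟨j, X, h1, h2, h3, -, h4⟩ := Frame.main H hC hW
  refine ⟨X, h1, h2, h3, fun s => ?_⟩
  obtain ⟨R, ⟨i, hi⟩, m, hm⟩ := h4 s
  exact ⟨i, m, fun n hn hx => hi n (hm n hn hx)⟩

end RRT

namespace RRT

/-- single-sided forcing data -/
structure SF where
  Good : Orc → List ℕ → Prop
  Bd : Orc → Prop
  goodEO : EO (fun I E => Good I E)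
  ngoodEO : EO (fun I E => ¬ Good I E)
  mono : ∀ I E E', (∀ x ∈ E', x ∈ E) → Good I E → Good I E'
  bdEO : EO (fun I (_ : Unit) => ¬ Bd I)

def SF.toFrame (A : SF) : Frame where
  Good _ I E := A.Good I E
  Bd := A.Bd
  Lk I F y := ∀ j, A.Good I (y :: F j)
  goodEO _ := A.goodEO
  mono _ := A.mono
  bdEO := A.bdEO
  lkEO F := by
    have h : ∀ j, EO (fun I y => ¬ A.Good I (y :: F j)) := fun j =>
      A.ngoodEO.comp (f := fun y => y :: F j) (Primrec.list_cons.comp Primrec.id (Primrec.const _))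
    refine EO.of_iff ((h false).or (h true)) ?_
    intro I y
    rw [Bool.forall_bool, not_and_or]

theorem SF.main (A : SF) {W Z C I0 : Orc} {F0 : List ℕ} (hC : Inf C) (hW : ¬ Red W (jn C Z))
    (hbd : A.Bd I0) (hg0 : A.Good I0 F0)
    (look : ∀ F : List ℕ, A.Good I0 F → (∀ x ∈ F, x ∈ F0 ∨ C x = true) →
      ∃ m, ∀ y, m ≤ y → C y = true → A.Good I0 (y :: F))
    (weak : ∀ (I R Z' : Orc) (F : List ℕ), A.Bd I → Inf R → Sub R C → Red I Z' → Red R Z' →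
      ¬ Red W Z' → (∀ y, R y = true → A.Good I (y :: F)) →
      ∃ X, Sub X R ∧ Inf X ∧ ¬ Red W (jn X Z') ∧
        ∀ E : List ℕ, (∀ x ∈ E, X x = true) → A.Good I (F ++ E)) :
    ∃ X, Sub X C ∧ Inf X ∧ ¬ Red W (jn X Z) ∧
      ∀ E : List ℕ, (∀ x ∈ E, X x = true) → A.Good I0 (F0 ++ E) := by
  have H : A.toFrame.Hyp W Z C I0 (fun _ => F0) (fun _ _ => True) := by
    refine ⟨hbd, fun _ => hg0, fun F hF hm => ?_, ?_,
      fun s R h1 h2 h3 => ⟨R, fun _ h => h, h1, h3, trivial⟩, ?_⟩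
    · obtain ⟨m0, h0⟩ := look (F false) (hF false) (hm false)
      obtain ⟨m1, h1⟩ := look (F true) (hF true) (hm true)
      refine ⟨max m0 m1, fun y hy hc j => ?_⟩
      cases j
      · exact h0 y (le_trans (le_max_left _ _) hy) hc
      · exact h1 y (le_trans (le_max_right _ _) hy) hc
    · intro F R hg hm hi hs ha hl j m
      obtain ⟨y, h1, h2⟩ := hi m
      exact ⟨y, h1, h2, hl y h2 j⟩
    · intro I R Z' F hb hi hs hI hR ha hl
      obtain ⟨X, hX⟩ := weak I R Z' (F false) hb hi hs hI hR ha (fun y hy => hl y hy false)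
      exact ⟨false, X, hX⟩
  obtain ⟨j, X, h1, h2, h3, h4, -⟩ := Frame.main H hC hW
  exact ⟨X, h1, h2, h3, h4⟩

/-- the set coded by a binary string -/
def sel (τ : List Bool) : List ℕ :=
  (List.range τ.length).filterMap (fun i => if τ.getD i false = true then some i else none)

theorem primrec_sel : Primrec sel := by
  refine Primrec.listFilterMap (Primrec.list_range.comp Primrec.list_length) ?_
  refine Primrec.ite (Primrec.eq.comp ((Primrec.list_getD false).comp Primrec.fst Primrec.snd)
    (Primrec.const true)) (Primrec.option_some.comp Primrec.snd) (Primrec.const none)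

theorem mem_sel_pre (X : Orc) (m i : ℕ) : i ∈ sel (pre X m) ↔ i < m ∧ X i = true := by
  simp only [sel, pre_length, List.mem_filterMap, List.mem_range, List.getD_eq_getElem?_getD, pre_get]
  constructor
  · rintro ⟨a, h1, h2⟩
    split_ifs at h2 with h3
    simp only [Option.some.injEq] at h2
    subst h2
    simp only [h1, if_true, Option.getD_some] at h3
    exact ⟨h1, h3⟩
  · rintro ⟨h1, h2⟩
    exact ⟨i, h1, by simp [h1, h2]⟩

theorem pre_succ (X : Orc) (n : ℕ) : pre X (n + 1) = pre X n ++ [X n] := by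
  simp [pre, List.range_succ]

theorem exists_greedy (p : ℕ → List Bool → Prop) : ∃ X : Orc, ∀ n, X n = true ↔ p n (pre X n) := by
  classical
  let g : ℕ → List Bool := fun n => Nat.rec [] (fun n τ => τ ++ [decide (p n τ)]) n
  let X : Orc := fun n => decide (p n (g n))
  have h : ∀ n, pre X n = g n := by
    intro n
    induction n with
    | zero => rfl
    | succ n ih => rw [pre_succ, ih]
  refine ⟨X, fun n => ?_⟩
  rw [h n]
  simp [X]

theorem SF.thin (A : SF) {I R Z' : Orc} {F : List ℕ} (hI : Red I Z') (hR : Red R Z')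
    (hi : Inf R) (hF : A.Good I F)
    (look : ∀ E : List ℕ, (∀ x ∈ E, R x = true) → A.Good I (F ++ E) →
      ∃ m, ∀ y, m ≤ y → R y = true → A.Good I (y :: (F ++ E))) :
    ∃ X, Sub X R ∧ Inf X ∧ Red X Z' ∧ ∀ E : List ℕ, (∀ x ∈ E, X x = true) → A.Good I (F ++ E) := by
  obtain ⟨X, hX⟩ := exists_greedy (fun n τ => R n = true ∧ A.Good I (n :: (F ++ sel τ)))
  have hsub : Sub X R := fun n hn => ((hX n).1 hn).1
  have hgood : ∀ n, A.Good I (F ++ sel (pre X n)) := by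
    intro n
    induction n with
    | zero => exact A.mono _ _ _ (by simp [mem_sel_pre]) hF
    | succ n ih =>
      by_cases h : X n = true
      · refine A.mono _ _ _ ?_ ((hX n).1 h).2
        intro x hx
        simp only [List.mem_append, mem_sel_pre, List.mem_cons] at hx ⊢
        rcases hx with hx | ⟨hx, hx'⟩
        · exact Or.inr (Or.inl hx)
        · rcases Nat.lt_succ_iff_lt_or_eq.1 hx with h | h
          · exact Or.inr (Or.inr ⟨h, hx'⟩)
          · exact Or.inl h
      · refine A.mono _ _ _ ?_ ih
        intro x hx
        simp only [List.mem_append, mem_sel_pre] at hx ⊢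
        rcases hx with hx | ⟨hx, hx'⟩
        · exact Or.inl hx
        · rcases Nat.lt_succ_iff_lt_or_eq.1 hx with h' | h'
          · exact Or.inr ⟨h', hx'⟩
          · subst h'; exact absurd hx' h
  refine ⟨X, hsub, fun m => ?_, ?_, fun E hE => ?_⟩
  · by_contra hno
    push Not at hno
    obtain ⟨m', hm'⟩ := look (sel (pre X m)) (fun x hx => hsub x ((mem_sel_pre _ _ _).1 hx).2)
      (hgood m)
    obtain ⟨y, hy, hyR⟩ := hi (max m m')
    have hmy : m ≤ y := le_trans (le_max_left _ _) hy
    refine hno y hmy ((hX y).2 ⟨hyR, ?_⟩)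
    refine A.mono _ _ _ ?_ (hm' y (le_trans (le_max_right _ _) hy) hyR)
    intro x hx
    simp only [List.mem_append, mem_sel_pre, List.mem_cons] at hx ⊢
    rcases hx with hx | hx | ⟨hx, hx'⟩
    · exact Or.inl hx
    · exact Or.inr (Or.inl hx)
    · refine Or.inr (Or.inr ⟨?_, hx'⟩)
      by_contra hlt
      exact hno x (by omega) hx'
  · refine Red.trans ?_ (hI.jn hR)
    let P : Orc → ℕ × Bool → Prop := fun O x => ∃ τ : List Bool,
      (∀ m ∈ List.range τ.length,
        ((τ.getD m false = true ∧ rt O m = true ∧ A.Good (lf O) (m :: (F ++ sel (τ.take m)))) ∨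
        (τ.getD m false = false ∧ (rt O m = false ∨
          ¬ A.Good (lf O) (m :: (F ++ sel (τ.take m))))))) ∧
      (τ.length = x.1 + 1 ∧ τ.getD x.1 false = x.2)
    have hP : EO P := by
      refine EO.ex (α := ℕ × Bool) (β := List Bool) (EO.and ?_ (EO.prim ?_))
      · refine EO.ball (α := (ℕ × Bool) × List Bool) (β := ℕ)
          (P := fun O a m =>
          ((a.2.getD m false = true ∧ rt O m = true ∧ A.Good (lf O) (m :: (F ++ sel (a.2.take m)))) ∨
          (a.2.getD m false = false ∧ (rt O m = false ∨
          ¬ A.Good (lf O) (m :: (F ++ sel (a.2.take m))))))) ?_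
          (Primrec.list_range.comp (Primrec.list_length.comp Primrec.snd))
        have hm : Primrec (fun x : ((ℕ × Bool) × List Bool) × ℕ => x.2) := Primrec.snd
        have ht : Primrec (fun x : ((ℕ × Bool) × List Bool) × ℕ => x.1.2) :=
          Primrec.snd.comp Primrec.fst
        have hg : Primrec (fun x : ((ℕ × Bool) × List Bool) × ℕ => x.1.2.getD x.2 false) :=
          (Primrec.list_getD false).comp ht hm
        have hl : Primrec (fun x : ((ℕ × Bool) × List Bool) × ℕ =>
            x.2 :: (F ++ sel (x.1.2.take x.2))) :=
          Primrec.list_cons.comp hm (Primrec.list_append.comp (Primrec.const F)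
            (primrec_sel.comp (Primrec.list_take.comp hm ht)))
        refine EO.or (EO.and (EO.prim (Primrec.eq.comp hg (Primrec.const true))) (EO.and ?_ ?_))
          (EO.and (EO.prim (Primrec.eq.comp hg (Primrec.const false))) (EO.or ?_ ?_))
        · exact CM.query CM.id.rt hm (Primrec.const true)
        · exact EO.sub (P := fun I (x : ((ℕ × Bool) × List Bool) × ℕ) =>
            A.Good I (x.2 :: (F ++ sel (x.1.2.take x.2)))) (A.goodEO.comp hl) CM.id.lf
        · exact CM.query CM.id.rt hm (Primrec.const false)
        · exact EO.sub (P := fun I (x : ((ℕ × Bool) × List Bool) × ℕ) =>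
            ¬ A.Good I (x.2 :: (F ++ sel (x.1.2.take x.2)))) (A.ngoodEO.comp hl) CM.id.lf
      · refine PrimrecPred.and (Primrec.eq.comp (Primrec.list_length.comp Primrec.snd)
          (Primrec.succ.comp (Primrec.fst.comp Primrec.fst))) (Primrec.eq.comp
          ((Primrec.list_getD false).comp Primrec.snd (Primrec.fst.comp Primrec.fst))
          (Primrec.snd.comp Primrec.fst))
    refine Red.ofEO hP fun n b => ?_
    have hstep : ∀ m c, X m = c ↔
        ((c = true ∧ R m = true ∧ A.Good I (m :: (F ++ sel (pre X m)))) ∨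
        (c = false ∧ (R m = false ∨ ¬ A.Good I (m :: (F ++ sel (pre X m)))))) := by
      intro m c
      have := hX m
      cases c
      · simp only [Bool.false_eq_true, false_and, true_and, false_or]
        rw [← Bool.not_eq_true, this, not_and_or, Bool.not_eq_true]
      · simp only [true_and, Bool.true_eq_false, false_and, or_false]
        exact this
    have tk : ∀ k l, k ≤ l → (pre X l).take k = pre X k := by
      intro k l h
      unfold pre
      rw [← List.map_take, List.take_range, min_eq_left h]
    have gd : ∀ k l, k < l → (pre X l).getD k false = X k := by
      intro k l h
      simp [List.getD_eq_getElem?_getD, pre_get, h]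
    change X n = b ↔ ∃ τ : List Bool, _
    rw [lf_jn, rt_jn]
    constructor
    · rintro rfl
      refine ⟨pre X (n + 1), fun m hm => ?_, pre_length _ _, gd _ _ (by omega)⟩
      rw [pre_length, List.mem_range] at hm
      rw [gd _ _ hm, tk _ _ (by omega)]
      exact (hstep m _).1 rfl
    · rintro ⟨τ, h1, h2, h3⟩
      have key : ∀ m, m ≤ τ.length → τ.take m = pre X m := by
        intro m
        induction m with
        | zero => intro _; rfl
        | succ m ih =>
          intro hm
          have h4 := h1 m (List.mem_range.2 (by omega))
          rw [ih (by omega)] at h4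
          have h5 := (hstep m _).2 h4
          rw [List.take_add_one, ih (by omega), pre_succ, h5]
          have : m < τ.length := by omega
          simp [this]
      have h4 := key (n + 1) (by omega)
      rw [List.take_of_length_le (by omega)] at h4
      change τ.getD n false = b at h3
      rw [← h3, h4, gd _ _ (by omega)]
  · obtain ⟨n, hn⟩ : ∃ n, ∀ x ∈ E, x < n := ⟨E.sum + 1, fun x hx => by
      have := List.le_sum_of_mem hx
      omega⟩
    refine A.mono _ _ _ ?_ (hgood n)
    intro x hx
    simp only [List.mem_append, mem_sel_pre] at hx ⊢
    exact hx.imp id fun h => ⟨hn x h, hE x h⟩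

end RRT

namespace RRT

/-- product of two lists, as codes -/
def lp (l l' : List ℕ) : List ℕ := l.flatMap fun a => l'.map fun b => Nat.pair a b

theorem mem_lp {l l' : List ℕ} {c : ℕ} : c ∈ lp l l' ↔ c.unpair.1 ∈ l ∧ c.unpair.2 ∈ l' := by
  simp only [lp, List.mem_flatMap, List.mem_map]
  constructor
  · rintro ⟨a, ha, b, hb, rfl⟩
    simpa using ⟨ha, hb⟩
  · rintro ⟨h1, h2⟩
    exact ⟨_, h1, _, h2, by simp⟩

theorem primrec_lp {α : Type*} [Primcodable α] {f g : α → List ℕ} (hf : Primrec f)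
    (hg : Primrec g) : Primrec (fun a => lp (f a) (g a)) := by
  refine Primrec.list_flatMap hf ?_
  refine Primrec.list_map (hg.comp Primrec.fst) ?_
  exact Primrec₂.natPair.comp (Primrec.snd.comp Primrec.fst) Primrec.snd

/-- every object has at most one partner (up to tails) -/
def Bd (I : Orc) : Prop := ∀ c d : ℕ, I c = true → I d = true → c.unpair.1 = d.unpair.1 →
  c.unpair.2.unpair.2 = d.unpair.2.unpair.2

theorem bdEO : EO (fun I (_ : Unit) => ¬ Bd I) := by
  refine EO.of_iff (P := fun I (_ : Unit) => ∃ p : ℕ × ℕ, I p.1 = true ∧ I p.2 = true ∧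
    (p.1.unpair.1 = p.2.unpair.1 ∧ ¬ p.1.unpair.2.unpair.2 = p.2.unpair.2.unpair.2)) ?_ ?_
  · have h1 : Primrec (fun x : Unit × (ℕ × ℕ) => x.2.1) := Primrec.fst.comp Primrec.snd
    have h2 : Primrec (fun x : Unit × (ℕ × ℕ) => x.2.2) := Primrec.snd.comp Primrec.snd
    have u1 : Primrec (fun n : ℕ => n.unpair.1) := Primrec.fst.comp Primrec.unpair
    have u2 : Primrec (fun n : ℕ => n.unpair.2) := Primrec.snd.comp Primrec.unpair
    refine EO.ex (α := Unit) (β := ℕ × ℕ) (EO.and (EO.query h1 (Primrec.const true))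
      (EO.and (EO.query h2 (Primrec.const true)) (EO.prim (PrimrecPred.and
        (Primrec.eq.comp (u1.comp h1) (u1.comp h2)) (PrimrecPred.not
        (Primrec.eq.comp (u2.comp (u2.comp h1)) (u2.comp (u2.comp h2))))))))
  · intro I _
    unfold Bd
    push Not
    constructor
    · rintro ⟨c, d, h1, h2, h3, h4⟩
      exact ⟨(c, d), h1, h2, h3, h4⟩
    · rintro ⟨⟨c, d⟩, h1, h2, h3, h4⟩
      exact ⟨c, d, h1, h2, h3, h4⟩

theorem bd_bound {I : Orc} (hI : Bd I) (L : List ℕ) :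
    ∃ m, ∀ c : ℕ, I c = true → c.unpair.1 ∈ L → c.unpair.2.unpair.2 < m := by
  induction L with
  | nil => exact ⟨0, fun c _ h => by simp at h⟩
  | cons a L ih =>
    obtain ⟨m, hm⟩ := ih
    by_cases h : ∃ d, I d = true ∧ d.unpair.1 = a
    · obtain ⟨d, h1, h2⟩ := h
      refine ⟨max m (d.unpair.2.unpair.2 + 1), fun c hc hcL => ?_⟩
      rcases List.mem_cons.1 hcL with h3 | h3
      · rw [hI c d hc h1 (h3.trans h2.symm)]
        exact lt_of_lt_of_le (Nat.lt_succ_self _) (le_max_right _ _)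
      · exact lt_of_lt_of_le (hm c hc h3) (le_max_left _ _)
    · refine ⟨m, fun c hc hcL => ?_⟩
      rcases List.mem_cons.1 hcL with h3 | h3
      · exact absurd ⟨c, hc, h3⟩ h
      · exact hm c hc h3

def codeSF (g : List ℕ → List ℕ) (hg : Primrec g)
    (gm : ∀ E E', (∀ x ∈ E', x ∈ E) → ∀ c ∈ g E', c ∈ g E) (p : ℕ → Prop) (hp : PrimrecPred p) :
    SF where
  Good I E := ∀ c ∈ g E, p c → I c = false
  Bd := Bd
  goodEO := by
    refine EO.of_iff (EO.ball (P := fun I (_ : List ℕ) c => ¬ p c ∨ I c = false)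
      (EO.or (EO.prim (hp.comp Primrec.snd).not) (EO.query Primrec.snd (Primrec.const false))) hg) ?_
    intro I E
    simp only [imp_iff_not_or]
  ngoodEO := by
    refine EO.of_iff (EO.bex (P := fun I (_ : List ℕ) c => p c ∧ I c = true)
      (EO.and (EO.prim (hp.comp Primrec.snd)) (EO.query Primrec.snd (Primrec.const true))) hg) ?_
    intro I E
    push Not
    simp only [Bool.not_eq_false, ne_eq]
  mono I E E' h hg' := fun c hc => hg' c (gm E E' h c hc)
  bdEO := bdEO

def obj2 (E : List ℕ) : List ℕ := lp E E
def obj3 (E : List ℕ) : List ℕ := lp E (lp E E)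

def p2 (c : ℕ) : Prop := c.unpair.1.unpair.1 < c.unpair.1.unpair.2 ∧
  c.unpair.2.unpair.1 < c.unpair.2.unpair.2 ∧ c.unpair.1.unpair.2 < c.unpair.2.unpair.2

def incr (t : ℕ) : Prop := t.unpair.1 < t.unpair.2.unpair.1 ∧
  t.unpair.2.unpair.1 < t.unpair.2.unpair.2

def p3 (c : ℕ) : Prop := (incr c.unpair.1 ∧ incr c.unpair.2) ∧
  (c.unpair.1.unpair.2.unpair.2 < c.unpair.2.unpair.2.unpair.2 ∨
    (c.unpair.1.unpair.2.unpair.2 = c.unpair.2.unpair.2.unpair.2 ∧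
      c.unpair.1.unpair.2.unpair.1 < c.unpair.2.unpair.2.unpair.1))

theorem pu1 : Primrec (fun n : ℕ => n.unpair.1) := Primrec.fst.comp Primrec.unpair
theorem pu2 : Primrec (fun n : ℕ => n.unpair.2) := Primrec.snd.comp Primrec.unpair

theorem hp2 : PrimrecPred p2 :=
  PrimrecPred.and (Primrec.nat_lt.comp (pu1.comp pu1) (pu2.comp pu1))
    (PrimrecPred.and (Primrec.nat_lt.comp (pu1.comp pu2) (pu2.comp pu2))
      (Primrec.nat_lt.comp (pu2.comp pu1) (pu2.comp pu2)))

theorem hincr : PrimrecPred incr :=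
  PrimrecPred.and (Primrec.nat_lt.comp pu1 (pu1.comp pu2))
    (Primrec.nat_lt.comp (pu1.comp pu2) (pu2.comp pu2))

theorem hp3 : PrimrecPred p3 :=
  PrimrecPred.and (PrimrecPred.and (hincr.comp pu1) (hincr.comp pu2))
    (PrimrecPred.or (Primrec.nat_lt.comp (pu2.comp (pu2.comp pu1)) (pu2.comp (pu2.comp pu2)))
      (PrimrecPred.and (Primrec.eq.comp (pu2.comp (pu2.comp pu1)) (pu2.comp (pu2.comp pu2)))
        (Primrec.nat_lt.comp (pu1.comp (pu2.comp pu1)) (pu1.comp (pu2.comp pu2)))))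

theorem lp_mono {a a' b b' : List ℕ} (h : ∀ x ∈ a', x ∈ a) (h' : ∀ x ∈ b', x ∈ b) :
    ∀ x ∈ lp a' b', x ∈ lp a b := fun x hx => by
  rw [mem_lp] at hx ⊢
  exact ⟨h _ hx.1, h' _ hx.2⟩

theorem primrec_obj2 : Primrec obj2 := primrec_lp Primrec.id Primrec.id
theorem primrec_obj3 : Primrec obj3 := primrec_lp Primrec.id (primrec_lp Primrec.id Primrec.id)

def sf2 : SF := codeSF (fun E => lp (obj2 E) (obj2 E)) (primrec_lp primrec_obj2 primrec_obj2)
  (fun _ _ h => lp_mono (lp_mono h h) (lp_mono h h)) p2 hp2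
def sf3 : SF := codeSF (fun E => lp (obj3 E) (obj3 E)) (primrec_lp primrec_obj3 primrec_obj3)
  (fun _ _ h => lp_mono (lp_mono h (lp_mono h h)) (lp_mono h (lp_mono h h))) p3 hp3

def q4 (a b c d : ℕ) : ℕ := Nat.pair (Nat.pair a b) (Nat.pair c d)
def t3 (a b c : ℕ) : ℕ := Nat.pair a (Nat.pair b c)
def q6 (a b c d e f : ℕ) : ℕ := Nat.pair (t3 a b c) (t3 d e f)

theorem good2_iff {I : Orc} {E : List ℕ} : sf2.Good I E ↔
    ∀ x0 ∈ E, ∀ x1 ∈ E, ∀ y0 ∈ E, ∀ y1 ∈ E, x0 < x1 → y0 < y1 → x1 < y1 →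
      I (q4 x0 x1 y0 y1) = false := by
  constructor
  · intro h x0 a x1 b y0 c y1 d h1 h2 h3
    refine h (q4 x0 x1 y0 y1) ?_ ?_
    · simp [mem_lp, obj2, q4, a, b, c, d]
    · simp [p2, q4, h1, h2, h3]
  · intro h c hc hp
    simp only [mem_lp, obj2] at hc
    have := h _ hc.1.1 _ hc.1.2 _ hc.2.1 _ hc.2.2 hp.1 hp.2.1 hp.2.2
    simpa [q4] using this

theorem good3_iff {I : Orc} {E : List ℕ} : sf3.Good I E ↔
    ∀ x0 ∈ E, ∀ x1 ∈ E, ∀ x2 ∈ E, ∀ y0 ∈ E, ∀ y1 ∈ E, ∀ y2 ∈ E, x0 < x1 → x1 < x2 →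
      y0 < y1 → y1 < y2 → (x2 < y2 ∨ (x2 = y2 ∧ x1 < y1)) →
      I (q6 x0 x1 x2 y0 y1 y2) = false := by
  constructor
  · intro h x0 a x1 b x2 b' y0 c y1 d y2 d' h1 h2 h3 h4 h5
    refine h (q6 x0 x1 x2 y0 y1 y2) ?_ ?_
    · simp [mem_lp, obj3, q6, t3, a, b, c, d, b', d']
    · simp [p3, incr, q6, t3, h1, h2, h3, h4, h5]
  · intro h c hc hp
    simp only [mem_lp, obj3] at hc
    have := h _ hc.1.1 _ hc.1.2.1 _ hc.1.2.2 _ hc.2.1 _ hc.2.2.1 _ hc.2.2.2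
      hp.1.1.1 hp.1.1.2 hp.1.2.1 hp.1.2.2 hp.2
    simpa [q6, t3] using this

theorem look2 {I : Orc} (hI : Bd I) {F : List ℕ} (hF : sf2.Good I F) :
    ∃ m, ∀ y, m ≤ y → sf2.Good I (y :: F) := by
  obtain ⟨m, hm⟩ := bd_bound hI (obj2 F)
  rw [good2_iff] at hF
  refine ⟨max m (F.sum + 1), fun y hy => ?_⟩
  have h1 : m ≤ y := le_trans (le_max_left _ _) hy
  have h2 : ∀ x ∈ F, x < y := fun x hx => by
    have := List.le_sum_of_mem hx
    have := le_trans (le_max_right _ _) hy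
    omega
  rw [good2_iff]
  intro x0 a x1 b y0 c y1 d l1 l2 l3
  rw [List.mem_cons] at a b c d
  have bnd : ∀ z, (z = y ∨ z ∈ F) → z ≤ y := fun z hz => hz.elim (fun h => h.le)
    fun h => (h2 z h).le
  have B := bnd _ b
  have D := bnd _ d
  have a' : x0 ∈ F := a.resolve_left (by omega)
  have b' : x1 ∈ F := b.resolve_left (by omega)
  have c' : y0 ∈ F := c.resolve_left (by omega)
  rcases d with rfl | d
  · by_contra hc
    have := hm (q4 x0 x1 y0 y1) (by simpa using hc) (by simp [q4, obj2, mem_lp, a', b'])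
    simp only [q4, Nat.unpair_pair] at this
    omega
  · exact hF _ a' _ b' _ c' _ d l1 l2 l3

theorem thmA {W Z C h : Orc} {F : List ℕ} (hC : Inf C) (hW : ¬ Red W (jn C Z)) (hb : Bd h)
    (hF : sf2.Good h F) : ∃ X, Sub X C ∧ Inf X ∧ ¬ Red W (jn X Z) ∧
      ∀ E : List ℕ, (∀ x ∈ E, X x = true) → sf2.Good h (F ++ E) := by
  refine sf2.main hC hW hb hF ?_ ?_
  · intro F' hF' _
    obtain ⟨m, hm⟩ := look2 hb hF'
    exact ⟨m, fun y hy _ => hm y hy⟩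
  · intro I R Z' F' hb' hi hs hI hR ha hl
    obtain ⟨y, -, hy⟩ := hi 0
    obtain ⟨X, h1, h2, h3, h4⟩ := sf2.thin hI hR hi
      (sf2.mono _ _ _ (fun x hx => List.mem_cons_of_mem _ hx) (hl y hy)) (fun E _ hE => by
        obtain ⟨m, hm⟩ := look2 hb' hE
        exact ⟨m, fun y hy _ => hm y hy⟩)
    exact ⟨X, h1, h2, fun hr => ha (hr.trans (h3.jn (Red.refl _))), h4⟩

/-- the sections of a relation on triples -/
def sec (I : Orc) (c : ℕ) : Orc := fun y =>
  I (q6 c.unpair.1.unpair.1 c.unpair.1.unpair.2 y c.unpair.2.unpair.1 c.unpair.2.unpair.2 y)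

theorem sec_q4 (I : Orc) (a b c d y : ℕ) : sec I (q4 a b c d) y = I (q6 a b y c d y) := by
  simp [sec, q4]

/-- `h` is the limit of the sections of `I` along `C` -/
def Lim (I C h : Orc) : Prop := ∀ c, ∃ m, ∀ n, m ≤ n → C n = true → sec I c n = h c

theorem Lim.bd {I C h : Orc} (hl : Lim I C h) (hC : Inf C) (hI : Bd I) : Bd h := by
  intro c d hc hd e
  obtain ⟨m, hm⟩ := hl c
  obtain ⟨m', hm'⟩ := hl d
  obtain ⟨n, hn, hn'⟩ := hC (max m m')
  have h1 := (hm n (le_trans (le_max_left _ _) hn) hn').trans hc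
  have h2 := (hm' n (le_trans (le_max_right _ _) hn) hn').trans hd
  have := hI _ _ h1 h2 (by simp [q6, t3, e])
  simp only [q6, t3, Nat.unpair_pair, Nat.pair_eq_pair] at this
  exact this.1

theorem Lim.unif {I C h : Orc} (hl : Lim I C h) (L : List ℕ) :
    ∃ m, ∀ c ∈ L, ∀ n, m ≤ n → C n = true → sec I c n = h c := by
  induction L with
  | nil => exact ⟨0, by simp⟩
  | cons a L ih =>
    obtain ⟨m, hm⟩ := ih
    obtain ⟨m', hm'⟩ := hl a
    refine ⟨max m m', fun c hc n hn hn' => ?_⟩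
    rcases List.mem_cons.1 hc with rfl | hc
    · exact hm' n (le_trans (le_max_right _ _) hn) hn'
    · exact hm c hc n (le_trans (le_max_left _ _) hn) hn'

theorem coh_lim {W Z C : Orc} (hC : Inf C) (hW : ¬ Red W (jn C Z)) (I : Orc) :
    ∃ X h, Sub X C ∧ Inf X ∧ ¬ Red W (jn X Z) ∧ Lim I X h := by
  obtain ⟨X, h1, h2, h3, h4⟩ := coh hC hW (sec I)
  choose h hh using h4
  exact ⟨X, h, h1, h2, h3, hh⟩

theorem look3 {I C h : Orc} (hI : Bd I) (hl : Lim I C h) {F : List ℕ} (hF : sf3.Good I F)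
    (hF2 : sf2.Good h F) : ∃ m, ∀ y, m ≤ y → C y = true → sf3.Good I (y :: F) := by
  obtain ⟨m, hm⟩ := bd_bound hI (obj3 F)
  obtain ⟨m', hm'⟩ := hl.unif (lp (obj2 F) (obj2 F))
  rw [good3_iff] at hF
  rw [good2_iff] at hF2
  refine ⟨max m (max m' (F.sum + 1)), fun y hy hCy => ?_⟩
  have h1 : m ≤ y := le_trans (le_max_left _ _) hy
  have h1' : m' ≤ y := le_trans (le_max_left _ _) (le_trans (le_max_right _ _) hy)
  have h2 : ∀ x ∈ F, x < y := fun x hx => by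
    have := List.le_sum_of_mem hx
    have := le_trans (le_max_right _ _) (le_trans (le_max_right _ _) hy)
    omega
  rw [good3_iff]
  intro x0 a x1 b x2 b2 y0 c y1 d y2 d2 l1 l2 l3 l4 l5
  rw [List.mem_cons] at a b c d b2 d2
  have bnd : ∀ z, (z = y ∨ z ∈ F) → z ≤ y := fun z hz => hz.elim (fun h => h.le)
    fun h => (h2 z h).le
  have B := bnd _ b2
  have D := bnd _ d2
  have a' : x0 ∈ F := a.resolve_left (by omega)
  have b' : x1 ∈ F := b.resolve_left (by omega)
  have c' : y0 ∈ F := c.resolve_left (by omega)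
  have d' : y1 ∈ F := d.resolve_left (by omega)
  rcases d2 with rfl | d2
  · rcases b2 with rfl | b2
    · have l6 : x1 < y1 := by omega
      have e := hm' (q4 x0 x1 y0 y1) (by simp [mem_lp, obj2, q4, a', b', c', d']) _ h1' hCy
      rw [sec_q4] at e
      rw [e]
      exact hF2 _ a' _ b' _ c' _ d' l1 l3 l6
    · by_contra hc
      have := hm (q6 x0 x1 x2 y0 y1 y2) (by simpa using hc)
        (by simp [q6, t3, obj3, mem_lp, a', b', b2])
      simp only [q6, t3, Nat.unpair_pair] at this
      have := Nat.right_le_pair y1 y2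
      omega
  · have b3 : x2 ∈ F := b2.resolve_left (by have := h2 _ d2; omega)
    exact hF _ a' _ b' _ b3 _ c' _ d' _ d2 l1 l2 l3 l4 l5

theorem weak3 {W I R Z' : Orc} {F : List ℕ} (hb : Bd I) (hi : Inf R) (hI : Red I Z')
    (hR : Red R Z') (ha : ¬ Red W Z') (hl : ∀ y, R y = true → sf3.Good I (y :: F)) :
    ∃ X, Sub X R ∧ Inf X ∧ ¬ Red W (jn X Z') ∧
      ∀ E : List ℕ, (∀ x ∈ E, X x = true) → sf3.Good I (F ++ E) := by
  obtain ⟨C, h, c1, c2, c3, c4⟩ := coh_lim hi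
    (fun hr => ha (hr.trans (hR.jn (Red.refl _))) : ¬ Red W (jn R Z')) I
  have hF2 : sf2.Good h F := by
    rw [good2_iff]
    intro x0 a x1 b y0 c y1 d l1 l2 l3
    obtain ⟨m, hm⟩ := c4 (q4 x0 x1 y0 y1)
    obtain ⟨n, hn, hn'⟩ := c2 (max m (F.sum + 1))
    rw [← hm n (le_trans (le_max_left _ _) hn) hn', sec_q4]
    have h2 : ∀ x ∈ F, x < n := fun x hx => by
      have := List.le_sum_of_mem hx
      have := le_trans (le_max_right _ _) hn
      omega
    exact good3_iff.1 (hl n (c1 n hn')) x0 (by simp [a]) x1 (by simp [b]) n (by simp) y0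
      (by simp [c]) y1 (by simp [d]) n (by simp) l1 (h2 _ b) l2 (h2 _ d) (Or.inr ⟨rfl, l3⟩)
  obtain ⟨X, x1, x2, x3, x4⟩ := thmA c2 c3 (c4.bd c2 hb) hF2
  obtain ⟨y, -, hy⟩ := hi 0
  obtain ⟨X', y1, y2, y3, y4⟩ := sf3.thin (Z' := jn X Z') (hI.trans (Red.right _ _)) (Red.left _ _)
    x2 (sf3.mono _ _ _ (fun x hx => List.mem_cons_of_mem _ hx) (hl y hy)) (fun E hE hg => by
      obtain ⟨m, hm⟩ := look3 hb c4 hg (x4 E hE)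
      exact ⟨m, fun y hy hX => hm y hy (x1 y hX)⟩)
  exact ⟨X', fun n hn => c1 n (x1 n (y1 n hn)), y2,
    fun hr => x3 (hr.trans (y3.jn (Red.right _ _))), y4⟩

theorem thmC {W Z I : Orc} (hW : ¬ Red W Z) (hI : Bd I) :
    ∃ X, Inf X ∧ ¬ Red W (jn X Z) ∧ ∀ E : List ℕ, (∀ x ∈ E, X x = true) → sf3.Good I E := by
  have hT : Red (fun _ => true) Z := Red.ofEO (P := fun _ x => x.2 = true)
    (EO.prim (Primrec.eq.comp Primrec.snd (Primrec.const true))) (fun n b => by simp [eq_comm])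
  obtain ⟨C, h, c1, c2, c3, c4⟩ := coh_lim (C := fun _ => true) (fun m => ⟨m, le_refl _, rfl⟩)
    (fun hr => hW (hr.trans (hT.jn (Red.refl _)))) I
  obtain ⟨X, x1, x2, x3, x4⟩ := thmA (F := []) c2 c3 (c4.bd c2 hI) (by rw [good2_iff]; simp)
  obtain ⟨Y, y1, y2, y3, y4⟩ := sf3.main (F0 := []) x2 x3 hI (by rw [good3_iff]; simp)
    (fun F hF hm => by
      obtain ⟨m, hm⟩ := look3 hI c4 hF (x4 F (by simpa using hm))
      exact ⟨m, fun y hy hX => hm y hy (x1 y hX)⟩)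
    (fun I R Z' F hb hi _ hI hR ha hl => weak3 hb hi hI hR ha hl)
  exact ⟨Y, y2, y3, y4⟩

theorem co_decide (A : Set ℕ) [DecidablePred (· ∈ A)] : co (fun n => decide (n ∈ A)) = chi A := by
  funext n
  by_cases h : n ∈ A <;> simp [co, chi, h]

end RRT

namespace RRT

theorem not_le_two {α : Type*} {S : Set α} (h : S.encard ≤ 2) {a b c : α} (ha : a ∈ S)
    (hb : b ∈ S) (hc : c ∈ S) (h1 : a ≠ b) (h2 : a ≠ c) (h3 : b ≠ c) : False := by
  have hs : ({a, b, c} : Set α) ⊆ S := by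
    intro x hx
    rcases hx with rfl | rfl | rfl <;> assumption
  have h4 := (Set.encard_le_encard hs).trans h
  rw [Set.encard_eq_three.2 ⟨a, b, c, h1, h2, h3, rfl⟩] at h4
  exact absurd h4 (by decide)

/-- decoded triple -/
def dt (t : ℕ) : ℕ × ℕ × ℕ := (t.unpair.1, t.unpair.2.unpair.1, t.unpair.2.unpair.2)

theorem dt_tail {s t : ℕ} (h : dt s = dt t) : s.unpair.2 = t.unpair.2 := by
  simp only [dt, Prod.mk.injEq] at h
  rw [← Nat.pair_unpair s.unpair.2, ← Nat.pair_unpair t.unpair.2, h.2.1, h.2.2]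

theorem mem_cls {f : ℕ → ℕ → ℕ → ℕ} {t c : ℕ} (h : incr t)
    (e : f t.unpair.1 t.unpair.2.unpair.1 t.unpair.2.unpair.2 = c) :
    dt t ∈ {t : ℕ × ℕ × ℕ | t.1 < t.2.1 ∧ t.2.1 < t.2.2 ∧ f t.1 t.2.1 t.2.2 = c} :=
  ⟨h.1, h.2, e⟩

/-- if `W ≰_T Z` and `f` is a 2-bounded coloring of `[ℕ]³` of arbitrary
complexity (no computability hypothesis), then there is an infinite tail `f`-rainbow `X`
with `W ≰_T X ⊕ Z`. -/
theorem statement13 (W Z : Set ℕ) (hWZ : ¬ TuringLE W Z) (f : ℕ → ℕ → ℕ → ℕ)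
    (hbounded : Bounded2Triples f) :
    ∃ X : Set ℕ, X.Infinite ∧ TailRainbow3On f X ∧ ¬ TuringLE W (join X Z) := by
  classical
  let fT : ℕ → ℕ := fun t => f t.unpair.1 t.unpair.2.unpair.1 t.unpair.2.unpair.2
  let I : Orc := fun c => decide (p3 c ∧ fT c.unpair.1 = fT c.unpair.2)
  have hI : Bd I := by
    intro c d hc hd he
    by_contra hne
    simp only [I, decide_eq_true_eq] at hc hd
    obtain ⟨⟨⟨c1, c2⟩, c3⟩, c4⟩ := hc
    obtain ⟨⟨⟨d1, d2⟩, d3⟩, d4⟩ := hd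
    have d5 : fT d.unpair.2 = fT c.unpair.1 := by rw [he]; exact d4.symm
    refine not_le_two (hbounded (fT c.unpair.1)) (mem_cls c1 rfl) (mem_cls c2 c4.symm)
      (mem_cls d2 d5) ?_ ?_ (fun h => hne (dt_tail h))
    · intro h
      have := dt_tail h
      rw [this] at c3
      omega
    · intro h
      rw [he] at h
      have := dt_tail h
      rw [this] at d3
      omega
  have hw : ¬ Red (fun n => decide (n ∈ W)) (fun n => decide (n ∈ Z)) := by
    unfold Red
    rw [co_decide, co_decide]
    exact hWZ
  obtain ⟨X, h1, h2, h3⟩ := thmC hw hI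
  refine ⟨{n | X n = true}, ?_, ?_, ?_⟩
  · refine Set.infinite_of_forall_exists_gt fun a => ?_
    obtain ⟨n, hn, hn'⟩ := h1 (a + 1)
    exact ⟨n, hn', hn⟩
  · have key : ∀ x0 x1 x2 y0 y1 y2 : ℕ, X x0 = true → X x1 = true → X x2 = true →
        X y0 = true → X y1 = true → X y2 = true → x0 < x1 → x1 < x2 → y0 < y1 → y1 < y2 →
        (x2 < y2 ∨ (x2 = y2 ∧ x1 < y1)) → f x0 x1 x2 ≠ f y0 y1 y2 := by
      intro x0 x1 x2 y0 y1 y2 a0 a1 a2 b0 b1 b2 l1 l2 l3 l4 l5 he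
      have g := h3 [x0, x1, x2, y0, y1, y2] (by simp [a0, a1, a2, b0, b1, b2])
      rw [good3_iff] at g
      have g := g x0 (by simp) x1 (by simp) x2 (by simp) y0 (by simp) y1 (by simp) y2 (by simp)
        l1 l2 l3 l4 l5
      simp only [I, decide_eq_false_iff_not] at g
      refine g ⟨⟨⟨?_, ?_⟩, ?_⟩, ?_⟩
      · simpa [incr, q6, t3] using ⟨l1, l2⟩
      · simpa [incr, q6, t3] using ⟨l3, l4⟩
      · simpa [q6, t3] using l5
      · simpa [fT, q6, t3] using he
    intro x0 x1 x2 y0 y1 y2 a0 a1 a2 b0 b1 b2 l1 l2 l3 l4 hne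
    have hne' : ¬ (x1 = y1 ∧ x2 = y2) := fun h => hne (by rw [h.1, h.2])
    by_cases hlt : x2 < y2 ∨ (x2 = y2 ∧ x1 < y1)
    · exact key _ _ _ _ _ _ a0 a1 a2 b0 b1 b2 l1 l2 l3 l4 hlt
    · exact (key _ _ _ _ _ _ b0 b1 b2 a0 a1 a2 l3 l4 l1 l2 (by omega)).symm
  · have hj : jn X (fun n => decide (n ∈ Z)) =
        fun n => decide (n ∈ join {n | X n = true} Z) := by
      funext n
      rcases Nat.even_or_odd' n with ⟨m, rfl | rfl⟩
      · rw [jn_even, Bool.eq_iff_iff, decide_eq_true_eq]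
        constructor
        · exact fun h => Or.inl ⟨m, h, rfl⟩
        · rintro (⟨k, hk, e⟩ | ⟨k, hk, e⟩)
          · have : m = k := by omega
            exact this ▸ hk
          · omega
      · rw [jn_odd, Bool.eq_iff_iff, decide_eq_true_eq, decide_eq_true_eq]
        constructor
        · exact fun h => Or.inr ⟨m, h, rfl⟩
        · rintro (⟨k, hk, e⟩ | ⟨k, hk, e⟩)
          · omega
          · have : m = k := by omega
            exact this ▸ hk
    intro hT
    apply h2
    rw [hj]
    unfold Red
    rw [co_decide, co_decide]
    exact hT

end RRT
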